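/- arXiv:2001.08778 — 4 statements merged into one kernel-verified Lean document; each statement's English description precedes it below -/
import Mathlib

section
/- Let 𝔻 = {w ∈ ℂ : |w| < 1} and let φ : 𝔻 → ℂ be a holomorphic injective map whose image is contained in 𝔻 \ (-1,0]. Let g be holomorphic on 𝔻 \ (-1,0] with |g(ρ)| ≤ C (1 - |ρ|)^{-K} for all ρ ∈ 𝔻 \ (-1,0], for some C > 0, K ≥ 0. Let a ≥ 0 and define q(ρ) = (4ρ/(1+ρ)^2)^{-a} using the principal complex power (this is well-defined since 4ρ/(1+ρ)^2 ∉ (-∞,0] for ρ ∈ 𝔻 \ (-1,0]). Then for every smooth 2π-periodic function f : ℝ → ℂ, the limit lim_{r→1⁻} ∫_0^{2π} q(φ(r e^{iθ})) g(φ(r e^{iθ})) f(θ) dθ exists and is finite. -/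
open MeasureTheory Filter Complex Metric

/-- The identity behind the pseudo-hyperbolic metric of the unit disk. -/
lemma norm_one_sub_conj_mul_sq (b z : ℂ) :
    ‖1 - (starRingEnd ℂ) b * z‖ ^ 2 - ‖z - b‖ ^ 2 = (1 - ‖b‖ ^ 2) * (1 - ‖z‖ ^ 2) := by
  simp only [Complex.sq_norm, Complex.normSq_apply, Complex.sub_re, Complex.sub_im, Complex.mul_re,
    Complex.mul_im, Complex.conj_re, Complex.conj_im, Complex.one_re, Complex.one_im]
  ring

/-- Quantitative Schwarz–Pick: a holomorphic self-map of the disk approaches the boundary at most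
linearly fast. -/
lemma exists_mul_one_sub_norm_le_of_mapsTo_ball {m : ℂ → ℂ}
    (hm : DifferentiableOn ℂ m (ball 0 1)) (hmaps : ∀ w ∈ ball (0 : ℂ) 1, ‖m w‖ < 1) :
    ∃ c > 0, ∀ w ∈ ball (0 : ℂ) 1, c * (1 - ‖w‖) ≤ 1 - ‖m w‖ := by
  set b := m 0 with hb
  have hb1 : ‖b‖ < 1 := hmaps 0 (by simp)
  have hb0 := norm_nonneg b
  have hden : ∀ w ∈ ball (0 : ℂ) 1, 1 - ‖b‖ ≤ ‖1 - (starRingEnd ℂ) b * m w‖ := by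
    intro w hw
    have h1 := norm_sub_norm_le (1 : ℂ) ((starRingEnd ℂ) b * m w)
    rw [norm_one, norm_mul, Complex.norm_conj] at h1
    nlinarith [hmaps w hw, norm_nonneg (m w)]
  have hden_ne : ∀ w ∈ ball (0 : ℂ) 1, 1 - (starRingEnd ℂ) b * m w ≠ 0 := fun w hw =>
    norm_pos_iff.1 (by linarith [hden w hw])
  set u : ℂ → ℂ := fun w => (m w - b) / (1 - (starRingEnd ℂ) b * m w) with hu
  have hud : DifferentiableOn ℂ u (ball 0 1) :=
    (hm.sub_const b).div ((hm.const_mul _).const_sub 1) hden_ne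
  have hkey : ∀ w ∈ ball (0 : ℂ) 1,
      ‖1 - (starRingEnd ℂ) b * m w‖ ^ 2 * (1 - ‖u w‖ ^ 2) = (1 - ‖b‖ ^ 2) * (1 - ‖m w‖ ^ 2) := by
    intro w hw
    have := norm_ne_zero_iff.2 (hden_ne w hw)
    rw [← norm_one_sub_conj_mul_sq, hu, norm_div]
    field_simp
  have hu1 : ∀ w ∈ ball (0 : ℂ) 1, ‖u w‖ ≤ 1 := by
    intro w hw
    have hpos := pow_pos (norm_pos_iff.2 (hden_ne w hw)) 2
    have h0 : 0 ≤ (1 - ‖b‖ ^ 2) * (1 - ‖m w‖ ^ 2) :=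
      mul_nonneg (by nlinarith) (by nlinarith [hmaps w hw, norm_nonneg (m w)])
    rw [← hkey w hw] at h0
    have := nonneg_of_mul_nonneg_right h0 hpos
    nlinarith [norm_nonneg (u w)]
  have hS : ∀ w ∈ ball (0 : ℂ) 1, ‖u w‖ ≤ ‖w‖ := fun w hw =>
    norm_le_norm_of_mapsTo_ball hud (fun z hz => by simpa using hu1 z hz)
      (by simp [hu, hb]) (by simpa using hw)
  refine ⟨(1 - ‖b‖) ^ 2 / 2, half_pos (pow_pos (by linarith) 2), fun w hw => ?_⟩
  have hw1 : ‖w‖ < 1 := by simpa using hw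
  have h1 : 1 - ‖w‖ ≤ 1 - ‖u w‖ ^ 2 := by
    nlinarith [hS w hw, hu1 w hw, norm_nonneg (u w)]
  have h2 : (1 - ‖b‖) ^ 2 * (1 - ‖w‖) ≤ ‖1 - (starRingEnd ℂ) b * m w‖ ^ 2 * (1 - ‖u w‖ ^ 2) :=
    mul_le_mul (pow_le_pow_left₀ (by linarith) (hden w hw) 2) h1 (by linarith) (by positivity)
  rw [hkey w hw] at h2
  have h3 : (1 - ‖b‖ ^ 2) * (1 - ‖m w‖ ^ 2) ≤ 1 - ‖m w‖ ^ 2 := by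
    have : 0 ≤ 1 - ‖m w‖ ^ 2 := by nlinarith [hmaps w hw, norm_nonneg (m w)]
    exact mul_le_of_le_one_left this (by linarith [sq_nonneg ‖b‖])
  nlinarith [hmaps w hw, norm_nonneg (m w)]

/-- A holomorphic function on the disk with values in the slit plane decays at most
quadratically at the boundary. -/
lemma exists_mul_sq_le_norm_of_mapsTo_slitPlane {φ : ℂ → ℂ}
    (hφ : DifferentiableOn ℂ φ (ball 0 1)) (hmaps : ∀ w ∈ ball (0 : ℂ) 1, φ w ∈ slitPlane) :
    ∃ c > 0, ∀ w ∈ ball (0 : ℂ) 1, c * (1 - ‖w‖) ^ 2 ≤ ‖φ w‖ := by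
  set F : ℂ → ℂ := fun w => Complex.exp (Complex.log (φ w) / 2) with hF
  have hFd : DifferentiableOn ℂ F (ball 0 1) := ((hφ.clog hmaps).div_const 2).cexp
  have hFsq : ∀ w ∈ ball (0 : ℂ) 1, F w ^ 2 = φ w := by
    intro w hw
    rw [hF, ← Complex.exp_nat_mul]
    push_cast
    rw [mul_div_cancel₀ _ (two_ne_zero), Complex.exp_log (slitPlane_ne_zero (hmaps w hw))]
  have hFre : ∀ w ∈ ball (0 : ℂ) 1, 0 < (F w).re := by
    intro w hw
    have him : (Complex.log (φ w) / 2).im = (φ w).arg / 2 := by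
      rw [← Complex.log_im, ← Complex.div_ofNat_im]
    simp only [hF]
    rw [Complex.exp_re, him]
    have h1 := Complex.neg_pi_lt_arg (φ w)
    have h2 := (Complex.arg_le_pi (φ w)).lt_of_ne (mem_slitPlane_iff_arg.1 (hmaps w hw)).1
    exact mul_pos (Real.exp_pos _) (Real.cos_pos_of_mem_Ioo ⟨by linarith, by linarith⟩)
  have hre1 : ∀ w ∈ ball (0 : ℂ) 1, 1 ≤ ‖F w + 1‖ := fun w hw => by
    have := Complex.re_le_norm (F w + 1)
    rw [Complex.add_re, Complex.one_re] at this
    linarith [hFre w hw]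
  have hne : ∀ w ∈ ball (0 : ℂ) 1, F w + 1 ≠ 0 := fun w hw =>
    norm_pos_iff.1 (by linarith [hre1 w hw])
  set m : ℂ → ℂ := fun w => (F w - 1) / (F w + 1) with hm
  have hid : ∀ w ∈ ball (0 : ℂ) 1, ‖F w + 1‖ ^ 2 * (1 - ‖m w‖ ^ 2) = 4 * (F w).re := by
    intro w hw
    have h0 := norm_ne_zero_iff.2 (hne w hw)
    have : ‖F w + 1‖ ^ 2 - ‖F w - 1‖ ^ 2 = 4 * (F w).re := by
      simp only [Complex.sq_norm, Complex.normSq_apply, Complex.sub_re, Complex.sub_im,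
        Complex.add_re, Complex.add_im, Complex.one_re, Complex.one_im]
      ring
    rw [← this, hm, norm_div]
    field_simp
  have hm1 : ∀ w ∈ ball (0 : ℂ) 1, ‖m w‖ < 1 := by
    intro w hw
    have h0 : 0 < ‖F w + 1‖ ^ 2 * (1 - ‖m w‖ ^ 2) := by rw [hid w hw]; linarith [hFre w hw]
    have := pos_of_mul_pos_right h0 (by positivity)
    nlinarith [norm_nonneg (m w)]
  obtain ⟨c, hc, h⟩ := exists_mul_one_sub_norm_le_of_mapsTo_ball
    ((hFd.sub_const 1).div (hFd.add_const 1) hne) hm1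
  refine ⟨(c / 4) ^ 2, by positivity, fun w hw => ?_⟩
  have hw1 : ‖w‖ < 1 := by simpa using hw
  have h1 : 1 - ‖m w‖ ≤ 1 - ‖m w‖ ^ 2 := by nlinarith [hm1 w hw, norm_nonneg (m w)]
  have h2 : 1 - ‖m w‖ ^ 2 ≤ 4 * (F w).re := by
    rw [← hid w hw]
    exact le_mul_of_one_le_left (by linarith [hm1 w hw]) (one_le_pow₀ (hre1 w hw))
  have h3 : c / 4 * (1 - ‖w‖) ≤ ‖F w‖ := by
    have h4 : c * (1 - ‖w‖) ≤ 1 - ‖m w‖ := h w hw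
    linarith [Complex.re_le_norm (F w)]
  rw [← mul_pow, ← hFsq w hw, norm_pow]
  exact pow_le_pow_left₀ (mul_nonneg (by positivity) (by linarith)) h3 2

/-- Points of the unit disk off the cut `(-1, 0]` lie in the slit plane. -/
lemma mem_slitPlane_of_mem_cutDisk {ρ : ℂ}
    (hρ : ρ ∈ ball (0 : ℂ) 1 \ (Complex.ofReal '' Set.Ioc (-1 : ℝ) 0)) : ρ ∈ slitPlane := by
  by_contra h
  rw [mem_slitPlane_iff, not_or, not_lt, not_not] at h
  have hn : ‖ρ‖ < 1 := by simpa using hρ.1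
  refine hρ.2 ⟨ρ.re, ⟨?_, h.1⟩, Complex.ext (by simp) (by simp [h.2])⟩
  linarith [(abs_le.1 (Complex.abs_re_le_norm ρ)).1]

/-- The Koebe function maps the cut disk into the slit plane. -/
lemma koebe_mem_slitPlane {ρ : ℂ} (hn : ‖ρ‖ < 1) (hs : ρ ∈ slitPlane) :
    4 * ρ / (1 + ρ) ^ 2 ∈ slitPlane := by
  have hne : 1 + ρ ≠ 0 := fun h => by
    rw [show ρ = -1 by linear_combination h] at hn
    simp at hn
  have hpos : 0 < 4 / normSq (1 + ρ) ^ 2 := by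
    have := normSq_pos.2 hne
    positivity
  have hrw : 4 * ρ / (1 + ρ) ^ 2
      = ((4 / normSq (1 + ρ) ^ 2 : ℝ) : ℂ) * (ρ * (starRingEnd ℂ) (1 + ρ) ^ 2) := by
    have h2 : (starRingEnd ℂ) (1 + ρ) ≠ 0 := (map_ne_zero _).2 hne
    rw [Complex.ofReal_div, Complex.ofReal_pow, Complex.normSq_eq_conj_mul_self]
    field_simp
    push_cast
    ring
  have hlt : ρ.re ^ 2 + ρ.im ^ 2 < 1 := by
    have : normSq ρ < 1 := by
      rw [← Complex.sq_norm]
      nlinarith [norm_nonneg ρ]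
    rw [normSq_apply] at this
    linarith
  have him : (ρ * (starRingEnd ℂ) (1 + ρ) ^ 2).im = ρ.im * (1 - (ρ.re ^ 2 + ρ.im ^ 2)) := by
    simp [pow_two]
    ring
  have hre : (ρ * (starRingEnd ℂ) (1 + ρ) ^ 2).re
      = ρ.re * (1 + (ρ.re ^ 2 + ρ.im ^ 2)) + 2 * (ρ.re ^ 2 + ρ.im ^ 2) := by
    simp [pow_two]
    ring
  rw [hrw, mem_slitPlane_iff, Complex.re_ofReal_mul, Complex.im_ofReal_mul, hre, him]
  rcases eq_or_ne ρ.im 0 with h0 | h0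
  · left
    have hρ : 0 < ρ.re := (mem_slitPlane_iff.1 hs).resolve_right (by simpa using h0)
    positivity
  · right
    exact mul_ne_zero hpos.ne' (mul_ne_zero h0 (by linarith))

lemma norm_koebe_cpow_neg_le {ρ : ℂ} (hn : ‖ρ‖ < 1) (h0 : ρ ≠ 0) {a : ℝ} (ha : 0 ≤ a) :
    ‖(4 * ρ / (1 + ρ) ^ 2) ^ (-(a : ℂ))‖ ≤ 1 / ‖ρ‖ ^ a := by
  have hne : 1 + ρ ≠ 0 := fun h => by
    rw [show ρ = -1 by linear_combination h] at hn
    simp at hn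
  have hρ : 0 < ‖ρ‖ := norm_pos_iff.2 h0
  have h1 : ‖(1 + ρ)‖ ^ 2 ≤ 4 := by
    have := norm_add_le 1 ρ
    rw [norm_one] at this
    nlinarith [norm_nonneg (1 + ρ)]
  have h2 : ‖ρ‖ ≤ ‖4 * ρ / (1 + ρ) ^ 2‖ := by
    have := norm_pos_iff.2 hne
    rw [norm_div, norm_mul, norm_pow, le_div_iff₀ (by positivity)]
    norm_num
    nlinarith
  rw [← Complex.ofReal_neg, Complex.norm_cpow_real, Real.rpow_neg (norm_nonneg _), ← one_div]
  exact one_div_le_one_div_of_le (by positivity) (Real.rpow_le_rpow hρ.le h2 ha)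

/-- If `t ≥ c s ^ p` with `s ∈ (0, 1]`, then `t⁻ᵏ` is at most a power of `s⁻¹`. -/
lemma exists_one_div_rpow_le {c k : ℝ} (hc : 0 < c) (hk : 0 ≤ k) (p : ℕ) :
    ∃ A > 0, ∃ N : ℕ, ∀ s t : ℝ, 0 < s → s ≤ 1 → c * s ^ p ≤ t → 1 / t ^ k ≤ A / s ^ N := by
  refine ⟨1 / c ^ k, by positivity, p * ⌈k⌉₊, fun s t hs hs1 ht => ?_⟩
  rw [div_div]
  have h1 : s ^ (p * ⌈k⌉₊) ≤ (s ^ p) ^ k := by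
    rw [pow_mul, ← Real.rpow_natCast (s ^ p)]
    exact Real.rpow_le_rpow_of_exponent_ge (by positivity) (pow_le_one₀ hs.le hs1)
      (Nat.le_ceil k)
  refine one_div_le_one_div_of_le (by positivity) ?_
  calc c ^ k * s ^ (p * ⌈k⌉₊) ≤ c ^ k * (s ^ p) ^ k := by gcongr
    _ = (c * s ^ p) ^ k := (Real.mul_rpow hc.le (by positivity)).symm
    _ ≤ t ^ k := Real.rpow_le_rpow (by positivity) ht hk

/-- Taylor coefficients of a holomorphic function of moderate growth grow polynomially. -/
lemma exists_taylorCoeff_norm_le {h : ℂ → ℂ} (hd : DifferentiableOn ℂ h (ball 0 1))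
    {A : ℝ} (hA : 0 ≤ A) {N : ℕ} (hb : ∀ w ∈ ball (0 : ℂ) 1, ‖h w‖ ≤ A / (1 - ‖w‖) ^ N) (n : ℕ) :
    ‖(n.factorial : ℂ)⁻¹ * iteratedDeriv n h 0‖ ≤ A * Real.exp 1 * (n + 2 : ℝ) ^ N := by
  set R : ℝ := (n + 1) / (n + 2) with hR
  have hn2 : (0 : ℝ) < n + 2 := by positivity
  have hR0 : 0 < R := by positivity
  have hR1 : 1 - R = 1 / (n + 2) := by
    rw [hR]
    field_simp
    ring
  have hR1' : R < 1 := by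
    have : 0 < 1 - R := by rw [hR1]; positivity
    linarith
  have hsub : closedBall (0 : ℂ) R ⊆ ball 0 1 := closedBall_subset_ball hR1'
  have hcl : DiffContOnCl ℂ h (ball 0 R) := by
    refine DifferentiableOn.diffContOnCl ?_
    rw [closure_ball _ hR0.ne']
    exact hd.mono hsub
  have hsph : ∀ z ∈ sphere (0 : ℂ) R, ‖h z‖ ≤ A * (n + 2) ^ N := by
    intro z hz
    have h1 := hb z (hsub (sphere_subset_closedBall hz))
    rw [mem_sphere_zero_iff_norm.1 hz, hR1] at h1
    simpa [div_eq_mul_inv] using h1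
  have hC := norm_iteratedDeriv_le_of_forall_mem_sphere_norm_le n hR0 hcl hsph
  have hpow : 1 / R ^ n ≤ Real.exp 1 := by
    have h1 : 1 / R = 1 / (n + 1) + 1 := by
      rw [hR]
      field_simp
      ring
    rw [← one_div_pow, h1]
    calc (1 / (n + 1) + 1 : ℝ) ^ n ≤ (Real.exp (1 / (n + 1))) ^ n := by
          gcongr
          exact Real.add_one_le_exp _
      _ = Real.exp (n * (1 / (n + 1))) := (Real.exp_nat_mul _ _).symm
      _ ≤ Real.exp 1 := by
          rw [Real.exp_le_exp, mul_one_div, div_le_one (by positivity)]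
          linarith
  have hfac : (0 : ℝ) < n.factorial := by positivity
  rw [norm_mul, norm_inv, Complex.norm_natCast]
  calc (n.factorial : ℝ)⁻¹ * ‖iteratedDeriv n h 0‖
      ≤ (n.factorial : ℝ)⁻¹ * (n.factorial * (A * (n + 2) ^ N) / R ^ n) := by gcongr
    _ = A * (1 / R ^ n) * (n + 2) ^ N := by field_simp
    _ ≤ A * Real.exp 1 * (n + 2) ^ N := by gcongr

lemma norm_exp_mul_I_pow (θ : ℝ) (n : ℕ) : ‖Complex.exp (θ * Complex.I) ^ n‖ = 1 := by
  rw [norm_pow, Complex.norm_exp_ofReal_mul_I, one_pow]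

/-- Fourier coefficients of a smooth periodic function decay rapidly. -/
lemma exists_fourier_integral_norm_le (k : ℕ) (f : ℝ → ℂ) (hf : ContDiff ℝ (⊤ : ℕ∞) f)
    (hper : ∀ θ : ℝ, f (θ + 2 * Real.pi) = f θ) :
    ∃ B ≥ 0, ∀ n : ℕ,
      ‖∫ θ in (0 : ℝ)..(2 * Real.pi), Complex.exp (θ * Complex.I) ^ n * f θ‖ * (n : ℝ) ^ k ≤ B := by
  induction k generalizing f with
  | zero =>
    refine ⟨∫ θ in (0 : ℝ)..(2 * Real.pi), ‖f θ‖,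
      intervalIntegral.integral_nonneg (by positivity) fun _ _ => norm_nonneg _, fun n => ?_⟩
    rw [pow_zero, mul_one]
    refine (intervalIntegral.norm_integral_le_integral_norm (by positivity)).trans_eq ?_
    simp_rw [norm_mul, norm_exp_mul_I_pow, one_mul]
  | succ k ih =>
    have hf' : ContDiff ℝ (⊤ : ℕ∞) (deriv f) := hf.deriv'
    have hper' : ∀ θ : ℝ, deriv f (θ + 2 * Real.pi) = deriv f θ := fun θ => by
      rw [← deriv_comp_add_const, funext hper]
    obtain ⟨B, hB, h⟩ := ih (deriv f) hf' hper'
    refine ⟨B, hB, fun n => ?_⟩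
    rcases Nat.eq_zero_or_pos n with rfl | hn
    · simpa using hB
    have hnC : (n : ℂ) * Complex.I ≠ 0 := mul_ne_zero (by exact_mod_cast hn.ne') Complex.I_ne_zero
    have hE : ∀ θ : ℝ, HasDerivAt (fun θ : ℝ => Complex.exp (θ * Complex.I) ^ n)
        ((n * Complex.I) * Complex.exp (θ * Complex.I) ^ n) θ := fun θ => by
      have h1 : HasDerivAt (fun θ : ℝ => Complex.exp (n * Complex.I * θ))
          (Complex.exp (n * Complex.I * θ) * (n * Complex.I * 1)) θ :=
        (((hasDerivAt_id (θ : ℂ)).const_mul (n * Complex.I)).cexp).comp_ofReal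
      have h2 : ∀ t : ℝ, Complex.exp (t * Complex.I) ^ n = Complex.exp (n * Complex.I * t) :=
        fun t => by rw [← Complex.exp_nat_mul]; ring_nf
      simp_rw [h2]
      convert! h1 using 1
      ring
    have hfd : ∀ θ : ℝ, HasDerivAt f (deriv f θ) θ := fun θ =>
      (hf.differentiable (by simp) θ).hasDerivAt
    have hibp := intervalIntegral.integral_mul_deriv_eq_deriv_mul
      (a := 0) (b := 2 * Real.pi) (fun θ _ => hfd θ) (fun θ _ => hE θ)
      (hf'.continuous.intervalIntegrable _ _)
      ((Continuous.intervalIntegrable (by fun_prop) _ _))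
    have hf2 : f (2 * Real.pi) = f 0 := by simpa using hper 0
    have he2 : Complex.exp (((2 * Real.pi : ℝ) : ℂ) * Complex.I) = 1 := by
      push_cast
      exact Complex.exp_two_pi_mul_I
    rw [hf2, he2] at hibp
    simp only [Complex.ofReal_zero, zero_mul, Complex.exp_zero, sub_self, zero_sub] at hibp
    have hL : (∫ θ in (0 : ℝ)..(2 * Real.pi),
          f θ * (n * Complex.I * Complex.exp (θ * Complex.I) ^ n))
        = n * Complex.I * ∫ θ in (0 : ℝ)..(2 * Real.pi), Complex.exp (θ * Complex.I) ^ n * f θ := by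
      rw [← intervalIntegral.integral_const_mul]
      congr 1
      ext θ
      ring
    have hnorm := congrArg norm (hL.symm.trans hibp)
    rw [norm_neg, norm_mul, norm_mul, Complex.norm_I, mul_one, Complex.norm_natCast] at hnorm
    rw [pow_succ]
    have := h n
    simp_rw [mul_comm (Complex.exp _ ^ n) (deriv f _)] at this
    calc _ = (n * ‖∫ θ in (0 : ℝ)..(2 * Real.pi), Complex.exp (θ * Complex.I) ^ n * f θ‖)
            * (n : ℝ) ^ k := by ring
      _ ≤ B := by rw [hnorm]; exact this

/-- A holomorphic function of moderate growth on the disk has a distributional boundary value. -/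
lemma exists_tendsto_integral_of_moderate_growth {h : ℂ → ℂ}
    (hd : DifferentiableOn ℂ h (ball 0 1)) {A : ℝ} (hA : 0 ≤ A) {N : ℕ}
    (hb : ∀ w ∈ ball (0 : ℂ) 1, ‖h w‖ ≤ A / (1 - ‖w‖) ^ N)
    {f : ℝ → ℂ} (hf : ContDiff ℝ (⊤ : ℕ∞) f) (hper : ∀ θ : ℝ, f (θ + 2 * Real.pi) = f θ) :
    ∃ L : ℂ, Tendsto (fun r : ℝ => ∫ θ in (0 : ℝ)..(2 * Real.pi),
      h (r * Complex.exp (θ * Complex.I)) * f θ) (nhdsWithin 1 (Set.Iio 1)) (nhds L) := by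
  set α : ℕ → ℂ := fun n => (n.factorial : ℂ)⁻¹ * iteratedDeriv n h 0 with hα
  set c : ℕ → ℂ := fun n =>
    ∫ θ in (0 : ℝ)..(2 * Real.pi), Complex.exp (θ * Complex.I) ^ n * f θ with hc
  have hαb := exists_taylorCoeff_norm_le hd hA hb
  have hsum : ∀ w ∈ ball (0 : ℂ) 1, HasSum (fun n => α n * w ^ n) (h w) := fun w hw => by
    convert! Complex.hasSum_taylorSeries_on_ball hd hw using 2 with n
    simp only [hα, sub_zero, smul_eq_mul]
    ring
  obtain ⟨M, hM⟩ : ∃ M, ∀ θ ∈ Set.uIcc (0 : ℝ) (2 * Real.pi), ‖f θ‖ ≤ M :=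
    isCompact_uIcc.exists_bound_of_continuousOn hf.continuous.continuousOn
  have hint : ∀ r : ℝ, 0 < r → r < 1 →
      HasSum (fun n => (r : ℂ) ^ n * (α n * c n)) (∫ θ in (0 : ℝ)..(2 * Real.pi),
        h (r * Complex.exp (θ * Complex.I)) * f θ) := by
    intro r hr0 hr1
    have hmem : ∀ θ : ℝ, (r : ℂ) * Complex.exp (θ * Complex.I) ∈ ball (0 : ℂ) 1 := fun θ => by
      rw [mem_ball_zero_iff, norm_mul, Complex.norm_exp_ofReal_mul_I, mul_one,
        Complex.norm_of_nonneg hr0.le]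
      exact hr1
    have hr : (r : ℂ) ∈ ball (0 : ℂ) 1 := by simpa using hmem 0
    have hs := ((hsum r hr).summable.norm).mul_right M
    have := intervalIntegral.hasSum_integral_of_dominated_convergence (μ := volume)
      (a := 0) (b := 2 * Real.pi)
      (F := fun n (θ : ℝ) => α n * (r * Complex.exp (θ * Complex.I)) ^ n * f θ)
      (f := fun θ => h (r * Complex.exp (θ * Complex.I)) * f θ)
      (fun n _ => ‖α n * (r : ℂ) ^ n‖ * M)
      (fun n => by
        have := hf.continuous
        exact Continuous.aestronglyMeasurable (by fun_prop))
      (fun n => ae_of_all _ fun θ hθ => by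
        rw [mul_pow, norm_mul, ← mul_assoc, norm_mul _ (_ ^ n), norm_exp_mul_I_pow, mul_one]
        gcongr
        exact hM θ (Set.uIoc_subset_uIcc hθ))
      (ae_of_all _ fun θ _ => hs)
      intervalIntegrable_const
      (ae_of_all _ fun θ _ => (hsum _ (hmem θ)).mul_right _)
    convert! this using 2 with n
    rw [hc, ← mul_assoc, ← intervalIntegral.integral_const_mul]
    congr 1
    ext θ
    ring
  obtain ⟨B, hB, hcB⟩ := exists_fourier_integral_norm_le (N + 2) f hf hper
  have hαc : ∀ n : ℕ, 1 ≤ n → ‖α n * c n‖ ≤ A * Real.exp 1 * 3 ^ N * B * (1 / (n : ℝ) ^ 2) := by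
    intro n hn
    have hn1 : (1 : ℝ) ≤ n := by exact_mod_cast hn
    have hn0 : (0 : ℝ) < n := by linarith
    have h1 : ‖c n‖ ≤ B / (n : ℝ) ^ (N + 2) := by
      rw [le_div_iff₀ (by positivity)]
      exact hcB n
    calc ‖α n * c n‖ = ‖α n‖ * ‖c n‖ := norm_mul _ _
      _ ≤ (A * Real.exp 1 * (3 * n : ℝ) ^ N) * (B / (n : ℝ) ^ (N + 2)) := by
          refine mul_le_mul ((hαb n).trans ?_) h1 (norm_nonneg _) (by positivity)
          gcongr
          linarith
      _ = A * Real.exp 1 * 3 ^ N * B * (1 / (n : ℝ) ^ 2) := by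
          rw [mul_pow, pow_add]
          field_simp
  have hsummable : Summable fun n => ‖α n * c n‖ := by
    have h2 : Summable fun n : ℕ => A * Real.exp 1 * 3 ^ N * B * (1 / (n : ℝ) ^ 2) :=
      (Real.summable_one_div_nat_pow.2 one_lt_two).mul_left _
    refine Summable.of_norm_bounded_eventually_nat h2 ?_
    filter_upwards [eventually_ge_atTop 1] with n hn
    rw [norm_norm]
    exact hαc n hn
  refine ⟨∑' n, α n * c n, ?_⟩
  have hIoo : Set.Ioo (0 : ℝ) 1 ∈ nhdsWithin (1 : ℝ) (Set.Iio 1) :=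
    Ioo_mem_nhdsLT one_pos
  have hT : Tendsto (fun r : ℝ => ∑' n, (r : ℂ) ^ n * (α n * c n)) (nhdsWithin 1 (Set.Iio 1))
      (nhds (∑' n, α n * c n)) := by
    refine tendsto_tsum_of_dominated_convergence hsummable (fun n => ?_) ?_
    · have : Continuous fun r : ℝ => (r : ℂ) ^ n * (α n * c n) := by fun_prop
      simpa using (this.tendsto 1).mono_left nhdsWithin_le_nhds
    · filter_upwards [hIoo] with r hr n
      rw [norm_mul, norm_pow, Complex.norm_of_nonneg hr.1.le]
      exact mul_le_of_le_one_left (norm_nonneg _) (pow_le_one₀ hr.1.le hr.2.le)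
  refine hT.congr' ?_
  filter_upwards [hIoo] with r hr
  exact (hint r hr.1 hr.2).tsum_eq

/-- **Pulled-back boundary values with the prefactor `q(ρ) = (4ρ/(1+ρ)²)^{-a} = z^{-a}`.**
With `φ : 𝔻 → 𝔻 \ (-1,0]` holomorphic injective and `g` holomorphic on the cut disk with a
power-law bound, for every smooth `2π`-periodic test function `f` the limit
`lim_{r→1⁻} ∫_0^{2π} q(φ(r e^{iθ})) g(φ(r e^{iθ})) f(θ) dθ` exists and is finite. -/
theorem pulled_back_boundary_value_with_prefactor_exists
    (φ : ℂ → ℂ)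
    (hφ : DifferentiableOn ℂ φ (ball (0 : ℂ) 1))
    (hinj : Set.InjOn φ (ball (0 : ℂ) 1))
    (himg : ∀ w ∈ ball (0 : ℂ) 1,
      φ w ∈ ball (0 : ℂ) 1 \ (Complex.ofReal '' Set.Ioc (-1 : ℝ) 0))
    (g : ℂ → ℂ)
    (hg : DifferentiableOn ℂ g
      (ball (0 : ℂ) 1 \ (Complex.ofReal '' Set.Ioc (-1 : ℝ) 0)))
    (C : ℝ) (hC : 0 < C) (K : ℝ) (hK : 0 ≤ K)
    (hbound : ∀ ρ ∈ ball (0 : ℂ) 1 \ (Complex.ofReal '' Set.Ioc (-1 : ℝ) 0),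
      ‖g ρ‖ ≤ C / (1 - ‖ρ‖) ^ K)
    (a : ℝ) (ha : 0 ≤ a)
    (q : ℂ → ℂ)
    (hqdef : ∀ ρ : ℂ, q ρ = (4 * ρ / (1 + ρ) ^ 2) ^ (-(a : ℂ)))
    (f : ℝ → ℂ)
    (hf : ContDiff ℝ (⊤ : ℕ∞) f)
    (hper : ∀ θ : ℝ, f (θ + 2 * Real.pi) = f θ) :
    ∃ Lim : ℂ,
      Tendsto
        (fun r : ℝ => ∫ θ in (0 : ℝ)..(2 * Real.pi),
          q (φ (↑r * Complex.exp (↑θ * Complex.I))) *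
            g (φ (↑r * Complex.exp (↑θ * Complex.I))) * f θ)
        (nhdsWithin 1 (Set.Iio 1)) (nhds Lim) := by
  have hslit : ∀ w ∈ ball (0 : ℂ) 1, φ w ∈ slitPlane := fun w hw =>
    mem_slitPlane_of_mem_cutDisk (himg w hw)
  have hn : ∀ w ∈ ball (0 : ℂ) 1, ‖φ w‖ < 1 := fun w hw => by simpa using (himg w hw).1
  have hd : DifferentiableOn ℂ (fun w => q (φ w) * g (φ w)) (ball 0 1) := by
    refine DifferentiableOn.mul ?_ (hg.comp hφ himg)
    simp_rw [hqdef]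
    refine DifferentiableOn.cpow_const ?_ fun w hw => koebe_mem_slitPlane (hn w hw) (hslit w hw)
    refine (hφ.const_mul 4).div ((hφ.const_add 1).pow 2) fun w hw => pow_ne_zero 2 fun h => ?_
    have := hn w hw
    rw [show φ w = -1 by linear_combination h] at this
    simp at this
  obtain ⟨c₁, hc₁, h₁⟩ := exists_mul_sq_le_norm_of_mapsTo_slitPlane hφ hslit
  obtain ⟨c₂, hc₂, h₂⟩ := exists_mul_one_sub_norm_le_of_mapsTo_ball hφ hn
  obtain ⟨A₁, hA₁, N₁, hb₁⟩ := exists_one_div_rpow_le hc₁ ha 2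
  obtain ⟨A₂, hA₂, N₂, hb₂⟩ := exists_one_div_rpow_le hc₂ hK 1
  refine exists_tendsto_integral_of_moderate_growth (A := A₁ * (C * A₂)) (N := N₁ + N₂) hd
    (by positivity) (fun w hw => ?_) hf hper
  have hw1 : ‖w‖ < 1 := by simpa using hw
  have hs : 0 < 1 - ‖w‖ := by linarith
  have hs1 : 1 - ‖w‖ ≤ 1 := by linarith [norm_nonneg w]
  have hq : ‖q (φ w)‖ ≤ A₁ / (1 - ‖w‖) ^ N₁ := by
    rw [hqdef]
    exact (norm_koebe_cpow_neg_le (hn w hw) (slitPlane_ne_zero (hslit w hw)) ha).trans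
      (hb₁ _ _ hs hs1 (h₁ w hw))
  have hgb : ‖g (φ w)‖ ≤ C * (A₂ / (1 - ‖w‖) ^ N₂) := by
    refine (hbound _ (himg w hw)).trans ?_
    rw [← mul_one_div]
    exact mul_le_mul_of_nonneg_left (hb₂ _ _ hs hs1 (by simpa using h₂ w hw)) hC.le
  rw [norm_mul]
  refine (mul_le_mul hq hgb (norm_nonneg _) (by positivity)).trans_eq ?_
  rw [pow_add]
  field_simp
end

section
/- Let (p_n) and (Δ_n) be sequences of nonnegative reals such that the series g(ρ) = ∑_n p_n ρ^{Δ_n} (principal complex powers) converges absolutely for every ρ in the cut disk 𝔻 \ (-1,0], and suppose ∑_n p_n r^{Δ_n} ≤ C (1-r)^{-K} for all r ∈ (0,1), for some C > 0, K ≥ 0. Let φ : 𝔻 → ℂ be a holomorphic injective map with image contained in 𝔻 \ (-1,0]. Then for every smooth 2π-periodic function f : ℝ → ℂ: (i) for each n the limit b_n := lim_{r→1⁻} ∫_0^{2π} φ(r e^{iθ})^{Δ_n} f(θ) dθ exists; (ii) the series ∑_n p_n b_n converges; and (iii) ∑_n p_n b_n = lim_{r→1⁻} ∫_0^{2π} g(φ(r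 e^{iθ})) f(θ) dθ, where the latter limit exists and is finite. -/
open MeasureTheory Filter Complex Metric
open scoped Topology ComplexConjugate

/-- A smooth `2π`-periodic function has rapidly decreasing Fourier coefficients. -/
lemma exists_norm_integral_exp_mul_le {f : ℝ → ℂ} (hf : ContDiff ℝ (⊤ : ℕ∞) f)
    (hper : ∀ θ : ℝ, f (θ + 2 * Real.pi) = f θ) (N : ℕ) :
    ∃ M : ℝ, ∀ k : ℕ, ‖∫ θ in (0 : ℝ)..(2 * Real.pi), exp (θ * I) ^ k * f θ‖ *
      ((k : ℝ) + 2) ^ N ≤ M := by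
  induction N generalizing f with
  | zero =>
    refine ⟨∫ θ in (0 : ℝ)..(2 * Real.pi), ‖f θ‖, fun k ↦ ?_⟩
    rw [pow_zero, mul_one]
    refine (intervalIntegral.norm_integral_le_integral_norm Real.two_pi_pos.le).trans_eq ?_
    simp [norm_exp_ofReal_mul_I]
  | succ N ih =>
    have hfd : ContDiff ℝ (⊤ : ℕ∞) (deriv f) := (contDiff_infty_iff_deriv.1 hf).2
    have hdiff : Differentiable ℝ f := (contDiff_infty_iff_deriv.1 hf).1
    have hperd : ∀ θ : ℝ, deriv f (θ + 2 * Real.pi) = deriv f θ := fun θ ↦ by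
      rw [← deriv_comp_add_const]
      congr 1
      exact funext hper
    obtain ⟨M₀, hM₀⟩ := ih hf hper
    obtain ⟨M₁, hM₁⟩ := ih hfd hperd
    refine ⟨2 * M₀ + M₁, fun k ↦ ?_⟩
    have hexp : ∀ θ : ℝ, HasDerivAt (fun θ : ℝ ↦ exp (θ * I) ^ k)
        (k * I * exp (θ * I) ^ k) θ := fun θ ↦ by
      have h := (((hasDerivAt_id (θ : ℂ)).mul_const (k * I)).cexp).comp_ofReal
      simp only [id, one_mul] at h
      have e : ∀ x : ℝ, exp (x * (k * I)) = exp (x * I) ^ k := fun x ↦ by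
        rw [← exp_nat_mul]; ring_nf
      simp only [e] at h
      rwa [mul_comm] at h
    have hparts := intervalIntegral.integral_mul_deriv_eq_deriv_mul
      (a := 0) (b := 2 * Real.pi) (fun x _ ↦ hexp x) (fun x _ ↦ (hdiff x).hasDerivAt)
      (Continuous.intervalIntegrable (by fun_prop) _ _)
      (hfd.continuous.intervalIntegrable _ _)
    have h2 : f (2 * Real.pi) = f 0 := by simpa using hper 0
    have hnorm : ‖∫ θ in (0 : ℝ)..(2 * Real.pi), exp (θ * I) ^ k * deriv f θ‖ =
        k * ‖∫ θ in (0 : ℝ)..(2 * Real.pi), exp (θ * I) ^ k * f θ‖ := by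
      rw [hparts, h2]
      push_cast
      rw [exp_two_pi_mul_I]
      simp only [mul_assoc, intervalIntegral.integral_const_mul]
      simp
    have h₀ := hM₀ k
    have h₁ := hM₁ k
    rw [hnorm] at h₁
    rw [pow_succ]
    linarith

/-- If the coefficients `A i` of a family of monomials `z ^ d i` are summable after division by a
power of the degree, then the boundary pairing of the sum with a smooth periodic function exists
and may be computed term by term. -/
lemma tendsto_integral_tsum_monomial {ι : Type*} [Countable ι] {d : ι → ℕ} {A : ι → ℂ} {N : ℕ}
    (hA : Summable fun i ↦ ‖A i‖ / ((d i : ℝ) + 2) ^ N)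
    {f : ℝ → ℂ} (hf : ContDiff ℝ (⊤ : ℕ∞) f) (hper : ∀ θ : ℝ, f (θ + 2 * Real.pi) = f θ) :
    (∀ z ∈ ball (0 : ℂ) 1, Summable fun i ↦ A i * z ^ d i) ∧
    (Summable fun i ↦ A i * ∫ θ in (0 : ℝ)..(2 * Real.pi), exp (θ * I) ^ d i * f θ) ∧
    Tendsto (fun r : ℝ ↦ ∫ θ in (0 : ℝ)..(2 * Real.pi),
        (∑' i, A i * (r * exp (θ * I)) ^ d i) * f θ) (𝓝[<] 1)
      (𝓝 (∑' i, A i * ∫ θ in (0 : ℝ)..(2 * Real.pi), exp (θ * I) ^ d i * f θ)) := by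
  set c : ℕ → ℂ := fun k ↦ ∫ θ in (0 : ℝ)..(2 * Real.pi), exp (θ * I) ^ k * f θ with hc
  have hpos : ∀ k : ℕ, (0 : ℝ) < ((k : ℝ) + 2) ^ N := fun k ↦ by positivity
  have hmaj : ∀ r : ℝ, 0 ≤ r → r < 1 → Summable fun i ↦ ‖A i‖ * r ^ d i := fun r hr0 hr1 ↦ by
    obtain ⟨B, hB⟩ : ∃ B : ℝ, ∀ k : ℕ, ((k : ℝ) + 2) ^ N * r ^ k ≤ B := by
      have h : Summable fun k : ℕ ↦ ((k : ℝ) + 2) ^ N * r ^ k := by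
        rcases hr0.eq_or_lt with rfl | hr0
        · refine summable_of_ne_finset_zero (s := {0}) fun k hk ↦ ?_
          simp at hk
          simp [hk]
        have h := (summable_nat_add_iff 2).2 (summable_pow_mul_geometric_of_norm_lt_one N
          (r := r) (by rwa [Real.norm_of_nonneg hr0.le]))
        refine (h.mul_left (r ^ 2)⁻¹).congr fun k ↦ ?_
        push_cast
        field_simp
        ring
      exact ⟨_, fun k ↦ h.le_tsum k fun j _ ↦ by positivity⟩
    refine Summable.of_nonneg_of_le (fun i ↦ by positivity) (fun i ↦ ?_) (hA.mul_left B)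
    calc ‖A i‖ * r ^ d i
        = ‖A i‖ / ((d i : ℝ) + 2) ^ N * (((d i : ℝ) + 2) ^ N * r ^ d i) := by
          have := (hpos (d i)).ne'
          field_simp
      _ ≤ ‖A i‖ / ((d i : ℝ) + 2) ^ N * B := by
          have := hB (d i)
          gcongr
      _ = _ := mul_comm _ _
  have hAc : Summable fun i ↦ ‖A i * c (d i)‖ := by
    obtain ⟨M, hM⟩ := exists_norm_integral_exp_mul_le hf hper N
    refine Summable.of_nonneg_of_le (fun i ↦ norm_nonneg _) (fun i ↦ ?_) (hA.mul_left M)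
    rw [norm_mul, mul_div_assoc', le_div_iff₀ (hpos _)]
    nlinarith [mul_le_mul_of_nonneg_left (hM (d i)) (norm_nonneg (A i))]
  refine ⟨fun z hz ↦ .of_norm ?_, .of_norm hAc, ?_⟩
  · simpa using hmaj ‖z‖ (norm_nonneg z) (by simpa using hz)
  have hlim : Tendsto (fun r : ℝ ↦ ∑' i, (r : ℂ) ^ d i * (A i * c (d i))) (𝓝[<] 1)
      (𝓝 (∑' i, A i * c (d i))) := by
    refine tendsto_tsum_of_dominated_convergence hAc (fun i ↦ ?_) ?_
    · have h : Continuous fun r : ℝ ↦ (r : ℂ) ^ d i * (A i * c (d i)) := by fun_prop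
      simpa using (h.tendsto 1).mono_left nhdsWithin_le_nhds
    · filter_upwards [Ioo_mem_nhdsLT (zero_lt_one' ℝ)] with r hr i
      rw [norm_mul]
      refine mul_le_of_le_one_left (norm_nonneg _) ?_
      rw [norm_pow, norm_real, Real.norm_of_nonneg hr.1.le]
      exact pow_le_one₀ hr.1.le hr.2.le
  refine hlim.congr' ?_
  filter_upwards [Ioo_mem_nhdsLT (zero_lt_one' ℝ)] with r hr
  have hnorm : ∀ (i : ι) (θ : ℝ), ‖A i * (r * exp (θ * I)) ^ d i‖ = ‖A i‖ * r ^ d i :=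
    fun i θ ↦ by simp [norm_exp_ofReal_mul_I, abs_of_nonneg hr.1.le]
  have hsum := intervalIntegral.hasSum_integral_of_dominated_convergence
    (μ := volume) (a := 0) (b := 2 * Real.pi)
    (F := fun i (θ : ℝ) ↦ A i * (r * exp (θ * I)) ^ d i * f θ)
    (f := fun θ : ℝ ↦ (∑' i, A i * (r * exp (θ * I)) ^ d i) * f θ)
    (fun i θ ↦ ‖A i‖ * r ^ d i * ‖f θ‖)
    (fun i ↦ Continuous.aestronglyMeasurable (by have := hf.continuous; fun_prop))
    (fun i ↦ ae_of_all _ fun θ _ ↦ by rw [norm_mul, hnorm])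
    (ae_of_all _ fun θ _ ↦ (hmaj r hr.1.le hr.2).mul_right _)
    (by
      simp only [tsum_mul_right]
      exact Continuous.intervalIntegrable (by have := hf.continuous; fun_prop) _ _)
    (ae_of_all _ fun θ _ ↦ by
      have h : Summable fun i ↦ A i * (r * exp (θ * I)) ^ d i :=
        .of_norm (by simpa only [hnorm] using hmaj r hr.1.le hr.2)
      exact h.hasSum.mul_right (f θ))
  rw [← hsum.tsum_eq]
  refine tsum_congr fun i ↦ ?_
  rw [hc, ← mul_assoc, ← intervalIntegral.integral_const_mul]
  refine intervalIntegral.integral_congr fun θ _ ↦ ?_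
  simp only [mul_pow]
  ring

/-- A holomorphic self-map of the unit disk sends `w` to a point whose distance to the unit
circle is at least a constant multiple of `1 - ‖w‖`. -/
lemma exists_mul_one_sub_norm_le {φ : ℂ → ℂ} (hφ : DifferentiableOn ℂ φ (ball 0 1))
    (hmaps : Set.MapsTo φ (ball 0 1) (ball 0 1)) :
    ∃ c : ℝ, 0 < c ∧ c ≤ 1 ∧ ∀ w ∈ ball (0 : ℂ) 1, c * (1 - ‖w‖) ≤ 1 - ‖φ w‖ := by
  set a := φ 0 with ha
  have ha1 : ‖a‖ < 1 := by simpa using hmaps (mem_ball_self one_pos)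
  have hφ1 : ∀ w ∈ ball (0 : ℂ) 1, ‖φ w‖ < 1 := fun w hw ↦ by simpa using hmaps hw
  have hden : ∀ z : ℂ, ‖z‖ < 1 → 1 - ‖a‖ ≤ ‖1 - conj a * z‖ := fun z hz ↦ by
    have h := norm_sub_norm_le 1 (conj a * z)
    rw [norm_mul, norm_one, norm_conj] at h
    nlinarith [norm_nonneg a]
  have hden0 : ∀ w ∈ ball (0 : ℂ) 1, 1 - conj a * φ w ≠ 0 := fun w hw ↦
    norm_pos_iff.1 ((sub_pos.2 ha1).trans_le (hden _ (hφ1 w hw)))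
  have hid : ∀ z : ℂ, ‖1 - conj a * z‖ ^ 2 - ‖z - a‖ ^ 2 = (1 - ‖a‖ ^ 2) * (1 - ‖z‖ ^ 2) :=
    fun z ↦ by
      simp only [Complex.sq_norm, normSq_apply]
      simp
      ring
  have hschwarz : ∀ w ∈ ball (0 : ℂ) 1, ‖(φ w - a) / (1 - conj a * φ w)‖ ≤ ‖w‖ := fun w hw ↦ by
    refine norm_le_norm_of_mapsTo_ball (R := 1) (f := fun w ↦ (φ w - a) / (1 - conj a * φ w))
      ((hφ.sub_const a).div ((hφ.const_mul (conj a)).const_sub 1) hden0) (fun w hw ↦ ?_)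
      (by simp [ha]) (by simpa using hw)
    rw [mem_closedBall_zero_iff, norm_div, div_le_one (norm_pos_iff.2 (hden0 w hw))]
    refine le_of_sq_le_sq ?_ (norm_nonneg _)
    have := hid (φ w)
    have h1 : 0 ≤ (1 - ‖a‖ ^ 2) * (1 - ‖φ w‖ ^ 2) := by
      apply mul_nonneg <;> nlinarith [norm_nonneg a, norm_nonneg (φ w), hφ1 w hw]
    linarith
  refine ⟨(1 - ‖a‖) / 4, by linarith, by linarith [norm_nonneg a], fun w hw ↦ ?_⟩
  have hw1 : ‖w‖ < 1 := by simpa using hw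
  have h1 := hschwarz w hw
  rw [norm_div, div_le_iff₀ (norm_pos_iff.2 (hden0 w hw))] at h1
  have h2 := hid (φ w)
  have h3 := hden _ (hφ1 w hw)
  have h4 : ‖φ w - a‖ ^ 2 ≤ (‖w‖ * ‖1 - conj a * φ w‖) ^ 2 := by gcongr
  have h5 : (1 - ‖a‖) ^ 2 ≤ ‖1 - conj a * φ w‖ ^ 2 := by
    have := sub_pos.2 ha1
    gcongr
  have hw2 : 1 - ‖w‖ ≤ 1 - ‖w‖ ^ 2 := by nlinarith [norm_nonneg w]
  have h6 : (1 - ‖a‖) ^ 2 * (1 - ‖w‖) ≤ (1 - ‖a‖ ^ 2) * (1 - ‖φ w‖ ^ 2) := by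
    rw [← h2]
    calc (1 - ‖a‖) ^ 2 * (1 - ‖w‖) ≤ ‖1 - conj a * φ w‖ ^ 2 * (1 - ‖w‖ ^ 2) := by
          have := sub_pos.2 hw1
          gcongr
      _ ≤ _ := by linarith [mul_pow ‖w‖ ‖1 - conj a * φ w‖ 2]
  have h7 : (1 - ‖a‖ ^ 2) * (1 - ‖φ w‖ ^ 2) ≤ (1 - ‖a‖) * (4 * (1 - ‖φ w‖)) := by
    have e : (1 - ‖a‖ ^ 2) * (1 - ‖φ w‖ ^ 2) =
      (1 - ‖a‖) * (((1 + ‖a‖) * (1 + ‖φ w‖)) * (1 - ‖φ w‖)) := by ring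
    rw [e]
    have h8 : (1 + ‖a‖) * (1 + ‖φ w‖) ≤ 4 := by
      nlinarith [norm_nonneg a, norm_nonneg (φ w), hφ1 w hw]
    have := sub_pos.2 ha1
    have := sub_pos.2 (hφ1 w hw)
    gcongr
  have h9 : (1 - ‖a‖) * (1 - ‖w‖) ≤ 4 * (1 - ‖φ w‖) :=
    le_of_mul_le_mul_left (by linarith) (sub_pos.2 ha1)
  linarith

/-- Cauchy's estimate for the `k`-th Taylor coefficient on the circle of radius
`(k + 1) / (k + 2)`. -/
lemma norm_taylor_coeff_le {u : ℂ → ℂ} (hu : DifferentiableOn ℂ u (ball 0 1)) (k : ℕ) {S : ℝ}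
    (hS : ∀ z : ℂ, ‖z‖ = 1 - 1 / ((k : ℝ) + 2) → ‖u z‖ ≤ S) :
    ‖(k.factorial : ℂ)⁻¹ * iteratedDeriv k u 0‖ ≤ 3 * S := by
  set r : ℝ := 1 - 1 / ((k : ℝ) + 2) with hr
  have hrk : r = ((k : ℝ) + 1) / (k + 2) := by rw [hr]; field_simp; ring
  have hr0 : 0 < r := by rw [hrk]; positivity
  have hr1 : r < 1 := by rw [hr]; linarith [show (0 : ℝ) < 1 / ((k : ℝ) + 2) by positivity]
  have hS0 : 0 ≤ S := (norm_nonneg _).trans (hS r (by simp [abs_of_pos hr0]))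
  have hcauchy := norm_iteratedDeriv_le_of_forall_mem_sphere_norm_le (c := 0) k hr0
    (DifferentiableOn.diffContOnCl
      (hu.mono (closure_ball_subset_closedBall.trans (closedBall_subset_ball hr1))))
    (fun z hz ↦ hS z (by simpa using hz))
  have hpow : (r ^ k)⁻¹ ≤ 3 := by
    have h1 : r⁻¹ ≤ Real.exp (1 / ((k : ℝ) + 1)) := by
      refine le_trans (le_of_eq ?_) (Real.add_one_le_exp _)
      rw [hrk]
      field_simp
      ring
    calc (r ^ k)⁻¹ = r⁻¹ ^ k := by rw [inv_pow]
      _ ≤ Real.exp (1 / ((k : ℝ) + 1)) ^ k := by gcongr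
      _ = Real.exp (k / ((k : ℝ) + 1)) := by rw [← Real.exp_nat_mul]; ring_nf
      _ ≤ Real.exp 1 := by
        gcongr
        rw [div_le_one (by positivity)]
        linarith
      _ ≤ 3 := by linarith [Real.exp_one_lt_d9]
  have hk : (0 : ℝ) < k.factorial := by positivity
  rw [norm_mul, norm_inv, norm_natCast]
  calc (k.factorial : ℝ)⁻¹ * ‖iteratedDeriv k u 0‖
      ≤ (k.factorial : ℝ)⁻¹ * (k.factorial * S / r ^ k) := by gcongr
    _ = (r ^ k)⁻¹ * S := by field_simp
    _ ≤ 3 * S := by gcongr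

lemma summable_one_div_add_two_sq : Summable fun k : ℕ ↦ 1 / ((k : ℝ) + 2) ^ 2 := by
  simpa using (summable_nat_add_iff 2).2 (Real.summable_one_div_nat_pow.2 one_lt_two)

/-- **Term-by-term distributional convergence of a positive power series on the pulled-back
boundary.** Given nonnegative `p n`, `Δ n` with `g(ρ) = ∑_n p_n ρ^{Δ_n}` absolutely
convergent on the cut disk and `∑_n p_n r^{Δ_n} ≤ C (1-r)^{-K}` on `(0,1)`, and a
holomorphic injective `φ : 𝔻 → 𝔻 \ (-1,0]`, the boundary pairings of the individual terms
exist, the series of pairings converges, and it equals the boundary pairing of `g`. -/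
theorem power_series_pulled_back_boundary_term_by_term
    (p Δ : ℕ → ℝ) (hp : ∀ n, 0 ≤ p n) (hΔ : ∀ n, 0 ≤ Δ n)
    (habs : ∀ ρ ∈ ball (0 : ℂ) 1 \ (Complex.ofReal '' Set.Ioc (-1 : ℝ) 0),
      Summable (fun n : ℕ => ‖(p n : ℂ) * ρ ^ (Δ n : ℂ)‖))
    (C : ℝ) (hC : 0 < C) (K : ℝ) (hK : 0 ≤ K)
    (hbound : ∀ r : ℝ, 0 < r → r < 1 →
      (∑' n : ℕ, p n * r ^ (Δ n)) ≤ C / (1 - r) ^ K)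
    (φ : ℂ → ℂ)
    (hφ : DifferentiableOn ℂ φ (ball (0 : ℂ) 1))
    (hinj : Set.InjOn φ (ball (0 : ℂ) 1))
    (himg : ∀ w ∈ ball (0 : ℂ) 1,
      φ w ∈ ball (0 : ℂ) 1 \ (Complex.ofReal '' Set.Ioc (-1 : ℝ) 0))
    (f : ℝ → ℂ)
    (hf : ContDiff ℝ (⊤ : ℕ∞) f)
    (hper : ∀ θ : ℝ, f (θ + 2 * Real.pi) = f θ) :
    ∃ b : ℕ → ℂ,
      (∀ n : ℕ, Tendsto
        (fun r : ℝ => ∫ θ in (0 : ℝ)..(2 * Real.pi),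
          (φ (↑r * Complex.exp (↑θ * Complex.I))) ^ (Δ n : ℂ) * f θ)
        (nhdsWithin 1 (Set.Iio 1)) (nhds (b n))) ∧
      Summable (fun n : ℕ => (p n : ℂ) * b n) ∧
      Tendsto
        (fun r : ℝ => ∫ θ in (0 : ℝ)..(2 * Real.pi),
          (∑' n : ℕ, (p n : ℂ) *
            (φ (↑r * Complex.exp (↑θ * Complex.I))) ^ (Δ n : ℂ)) * f θ)
        (nhdsWithin 1 (Set.Iio 1)) (nhds (∑' n : ℕ, (p n : ℂ) * b n)) := by
  have hslit : ∀ w ∈ ball (0 : ℂ) 1, φ w ∈ slitPlane := fun w hw ↦ by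
    obtain ⟨h1, h2⟩ := himg w hw
    by_contra h
    rw [mem_slitPlane_iff_not_le_zero, not_not] at h
    have hre : (((φ w).re : ℝ) : ℂ) = φ w := Complex.ext rfl (by simpa using (le_def.1 h).2.symm)
    refine h2 ⟨(φ w).re, ⟨?_, (le_def.1 h).1⟩, hre⟩
    have h3 := abs_re_le_norm (φ w)
    have h4 : ‖φ w‖ < 1 := by simpa using h1
    linarith [neg_abs_le (φ w).re]
  obtain ⟨c, hc0, hc1, hc⟩ := exists_mul_one_sub_norm_le hφ fun w hw ↦ (himg w hw).1
  set u : ℕ → ℂ → ℂ := fun n w ↦ φ w ^ (Δ n : ℂ) with hu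
  have hud : ∀ n, DifferentiableOn ℂ (u n) (ball 0 1) := fun n ↦ hφ.cpow_const hslit
  set a : ℕ → ℕ → ℂ := fun n k ↦ (k.factorial : ℂ)⁻¹ * iteratedDeriv k (u n) 0
  have htaylor : ∀ n, ∀ z ∈ ball (0 : ℂ) 1, ∑' k, a n k * z ^ k = u n z := fun n z hz ↦ by
    simpa using taylorSeries_eq_on_ball' hz (hud n)
  -- `m k` bounds `‖φ‖` on the circle of radius `1 - 1 / (k + 2)`
  set m : ℕ → ℝ := fun k ↦ 1 - c / ((k : ℝ) + 2) with hm
  have hm0 : ∀ k, 0 < m k := fun k ↦ by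
    rw [hm, sub_pos, div_lt_one (by positivity)]
    linarith [(Nat.cast_nonneg k : (0 : ℝ) ≤ k)]
  have hm1 : ∀ k, m k < 1 := fun k ↦ sub_lt_self _ (by positivity)
  have hcoeff : ∀ n k, ‖a n k‖ ≤ 3 * m k ^ Δ n := fun n k ↦ by
    refine norm_taylor_coeff_le (hud n) k fun z hz ↦ ?_
    have hz1 : ‖z‖ < 1 := by rw [hz]; exact sub_lt_self _ (by positivity)
    have h := hc z (by simpa using hz1)
    rw [hu, norm_cpow_real]
    refine Real.rpow_le_rpow (norm_nonneg _) ?_ (hΔ n)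
    rw [hz, sub_sub_cancel, mul_one_div] at h
    linarith
  have hsumm : ∀ k, Summable fun n ↦ p n * m k ^ Δ n := fun k ↦ by
    refine (habs (m k) ⟨?_, ?_⟩).congr fun n ↦ ?_
    · simpa [abs_of_pos (hm0 k)] using hm1 k
    · rintro ⟨x, hx, hxm⟩
      exact (hm0 k).not_ge (ofReal_injective hxm ▸ hx.2)
    · rw [norm_mul, norm_cpow_real, norm_real, norm_real, Real.norm_of_nonneg (hp n),
        Real.norm_of_nonneg (hm0 k).le]
  have hsingle : ∀ n, Summable fun k : ℕ ↦ ‖a n k‖ / ((k : ℝ) + 2) ^ 2 := fun n ↦ by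
    refine .of_nonneg_of_le (fun k ↦ by positivity) (fun k ↦ ?_)
      (summable_one_div_add_two_sq.mul_left 3)
    rw [mul_one_div]
    gcongr
    have := Real.rpow_le_one (hm0 k).le (hm1 k).le (hΔ n)
    linarith [hcoeff n k]
  set N : ℕ := ⌈K⌉₊ + 2 with hN
  have hbound' : ∀ k : ℕ, (∑' n, p n * m k ^ Δ n) / ((k : ℝ) + 2) ^ N ≤
      C / c ^ K * (1 / ((k : ℝ) + 2) ^ 2) := fun k ↦ by
    have hk : (0 : ℝ) < (k : ℝ) + 2 := by positivity
    have h1 := hbound (m k) (hm0 k) (hm1 k)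
    rw [hm, sub_sub_cancel, Real.div_rpow hc0.le hk.le] at h1
    have h2 : ((k : ℝ) + 2) ^ K ≤ ((k : ℝ) + 2) ^ ⌈K⌉₊ := by
      rw [← Real.rpow_natCast]
      exact Real.rpow_le_rpow_of_exponent_le (by linarith [(Nat.cast_nonneg k : (0 : ℝ) ≤ k)])
        (Nat.le_ceil K)
    have hcK : 0 < c ^ K := Real.rpow_pos_of_pos hc0 K
    rw [div_le_iff₀ (by positivity), hN, pow_add]
    refine h1.trans ?_
    calc C / (c ^ K / ((k : ℝ) + 2) ^ K) = C / c ^ K * ((k : ℝ) + 2) ^ K := by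
          rw [div_div_eq_mul_div, mul_div_right_comm]
      _ ≤ C / c ^ K * ((k : ℝ) + 2) ^ ⌈K⌉₊ := by gcongr
      _ = _ := by field_simp
  clear_value N m
  have hdouble : Summable fun i : ℕ × ℕ ↦ ‖(p i.1 : ℂ) * a i.1 i.2‖ / ((i.2 : ℝ) + 2) ^ N := by
    have h : Summable fun i : ℕ × ℕ ↦
        3 * (p i.2 * m i.1 ^ Δ i.2) / ((i.1 : ℝ) + 2) ^ N := by
      refine (summable_prod_of_nonneg fun i ↦ ?_).2
        ⟨fun k ↦ ?_, ?_⟩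
      · have := hp i.2
        have := Real.rpow_nonneg (hm0 i.1).le (Δ i.2)
        simp only [Pi.zero_apply]
        positivity
      · exact ((hsumm k).mul_left 3).div_const (((k : ℝ) + 2) ^ N)
      · simp only [tsum_div_const, tsum_mul_left]
        simp only [mul_div_assoc]
        refine .mul_left 3 (.of_nonneg_of_le (fun k ↦ ?_) hbound'
          (summable_one_div_add_two_sq.mul_left _))
        exact div_nonneg (tsum_nonneg fun n ↦ mul_nonneg (hp n)
          (Real.rpow_nonneg (hm0 k).le _)) (by positivity)
    refine .of_nonneg_of_le (fun i ↦ by positivity) (fun i ↦ ?_) h.prod_symm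
    rw [norm_mul, norm_real, Real.norm_of_nonneg (hp i.1)]
    simp only [Prod.fst_swap, Prod.snd_swap]
    gcongr ?_ / _
    nlinarith [mul_le_mul_of_nonneg_left (hcoeff i.1 i.2) (hp i.1)]
  obtain ⟨hz, hb, hlim⟩ := tendsto_integral_tsum_monomial hdouble hf hper
  have hball : ∀ r ∈ Set.Ioo (0 : ℝ) 1, ∀ θ : ℝ, (r : ℂ) * exp (θ * I) ∈ ball (0 : ℂ) 1 :=
    fun r hr θ ↦ by simpa [norm_exp_ofReal_mul_I, abs_of_pos hr.1] using hr.2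
  simp only [mul_assoc] at hb hlim hz
  have hbn := hb.prod
  have hbt := hb.tsum_prod
  simp only [tsum_mul_left] at hbn hbt
  refine ⟨fun n ↦ ∑' k, a n k * ∫ θ in (0 : ℝ)..(2 * Real.pi), exp (θ * I) ^ k * f θ,
    fun n ↦ ?_, hbn, ?_⟩
  · refine (tendsto_integral_tsum_monomial (d := id) (hsingle n) hf hper).2.2.congr' ?_
    filter_upwards [Ioo_mem_nhdsLT (zero_lt_one' ℝ)] with r hr
    refine intervalIntegral.integral_congr fun θ _ ↦ ?_
    simp only [id, htaylor n _ (hball r hr θ), hu]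
  · rw [← hbt]
    refine hlim.congr' ?_
    filter_upwards [Ioo_mem_nhdsLT (zero_lt_one' ℝ)] with r hr
    refine intervalIntegral.integral_congr fun θ _ ↦ ?_
    simp only [(hz _ (hball r hr θ)).tsum_prod, tsum_mul_left, htaylor _ _ (hball r hr θ), hu]
end

section
/- Let d ≥ 1, let V ⊆ ℝ^d be an open convex cone with vertex at 0 not containing 0, and let a > 0. Let g : ℂ^d → ℂ be holomorphic on the region W = {x + iy ∈ ℂ^d : y ∈ V, ‖y‖ < a} and suppose there exist C > 0 and nonnegative integers L, K such that |g(x+iy)| ≤ C (1 + ‖x‖^2)^L ‖y‖^{-2K} for all x + iy ∈ W. Then for every v ∈ V and every Schwartz function f : ℝ^d → ℂ, the limit lim_{ε→0+} ∫_{ℝ^d} g(x + iεv) f(x) dx exists and is finite, and the map sending f to this limit is a tempered distribution, i.e. a continuous linear functional on the Schwartz space S(ℝ^d). -/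
open MeasureTheory Filter Complex

/-- Taylor bound: if `u 0, u 1, …` are successive derivatives on `(0, δ)`, each of which is
`O(t⁻ᵐ)`, then `u 0` is bounded near `0`. -/
theorem norm_le_of_hasDerivAt_of_norm_le_div_pow {E : Type*} [NormedAddCommGroup E]
    [NormedSpace ℝ E] {u : ℕ → ℝ → E} {B : ℕ → ℝ} {δ τ t : ℝ} {m : ℕ}
    (hu : ∀ j, ∀ s, 0 < s → s < δ → HasDerivAt (u j) (u (j + 1) s) s)
    (hB : ∀ j, ∀ s, 0 < s → s < δ → ‖u j s‖ ≤ B j / s ^ m)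
    (hτ : τ < δ) (ht : 0 < t) (htτ : t ≤ τ) :
    ‖u 0 t‖ ≤ ∑ j ∈ Finset.range (m + 1), B j / τ ^ m * τ ^ j + B (m + 1) * τ := by
  have hτ0 : 0 < τ := ht.trans_le htτ
  have hB0 (j : ℕ) : 0 ≤ B j := by
    have h := (norm_nonneg _).trans (hB j τ hτ0 hτ)
    rcases div_nonneg_iff.1 h with h | h
    · exact h.1
    · exact absurd h.2 (pow_pos hτ0 m).not_ge
  let G (n : ℕ) (s : ℝ) : E := ∑ j ∈ Finset.range (n + 1), ((t - s) ^ j / (j.factorial : ℝ)) • u j s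
  have hG (n : ℕ) (s : ℝ) (h0 : 0 < s) (h1 : s < δ) :
      HasDerivAt (G n) (((t - s) ^ n / (n.factorial : ℝ)) • u (n + 1) s) s := by
    induction n with
    | zero => simpa [G] using hu 0 s h0 h1
    | succ n ih =>
      have hsucc : G (n + 1) =
          fun s ↦ G n s + ((t - s) ^ (n + 1) / ((n + 1).factorial : ℝ)) • u (n + 1) s := by
        funext s
        simp only [G]
        rw [Finset.sum_range_succ _ (n + 1)]
      rw [hsucc]
      have hp : HasDerivAt (fun s : ℝ ↦ (t - s) ^ (n + 1) / ((n + 1).factorial : ℝ))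
          (-((t - s) ^ n / (n.factorial : ℝ))) s := by
        have h := ((((hasDerivAt_id s).const_sub t).pow (n + 1)).div_const
          ((n + 1).factorial : ℝ))
        refine h.congr_deriv ?_
        rw [Nat.factorial_succ]
        push_cast
        simp only [id]
        field_simp
      refine (ih.add (hp.smul (hu (n + 1) s h0 h1))).congr_deriv ?_
      module
  have hmv : ‖G m τ - G m t‖ ≤ B (m + 1) * (τ - t) := by
    refine norm_image_sub_le_of_norm_deriv_le_segment'
      (f' := fun s ↦ ((t - s) ^ m / (m.factorial : ℝ)) • u (m + 1) s)
      (fun s hs ↦ (hG m s (ht.trans_le hs.1) (hs.2.trans_lt hτ)).hasDerivWithinAt)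
      (fun s hs ↦ ?_) τ ⟨htτ, le_rfl⟩
    have hs0 : 0 < s := ht.trans_le hs.1
    have hfac : (1 : ℝ) ≤ m.factorial := by exact_mod_cast Nat.succ_le_of_lt m.factorial_pos
    have habs : |t - s| ≤ s := by
      rw [abs_sub_comm, abs_of_nonneg (by linarith [hs.1])]
      linarith
    rw [norm_smul, Real.norm_eq_abs, abs_div, abs_pow, Nat.abs_cast]
    calc |t - s| ^ m / (m.factorial : ℝ) * ‖u (m + 1) s‖
        ≤ s ^ m / 1 * (B (m + 1) / s ^ m) := by
          gcongr
          exact hB (m + 1) s hs0 (hs.2.trans_le hτ.le)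
      _ = B (m + 1) := by field_simp
  have hGt : G m t = u 0 t := by
    simp [G, Finset.sum_range_succ']
  have hGτ : ‖G m τ‖ ≤ ∑ j ∈ Finset.range (m + 1), B j / τ ^ m * τ ^ j := by
    refine norm_sum_le_of_le _ fun j _ ↦ ?_
    have hfac : (1 : ℝ) ≤ j.factorial := by exact_mod_cast Nat.succ_le_of_lt j.factorial_pos
    have habs : |t - τ| ≤ τ := by
      rw [abs_sub_comm, abs_of_nonneg (by linarith)]
      linarith
    rw [norm_smul, Real.norm_eq_abs, abs_div, abs_pow, Nat.abs_cast, mul_comm]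
    calc ‖u j τ‖ * (|t - τ| ^ j / (j.factorial : ℝ))
        ≤ B j / τ ^ m * (τ ^ j / 1) := by
          have := hB0 j
          gcongr
          exact hB j τ hτ0 hτ
      _ = _ := by rw [div_one]
  rw [← hGt]
  calc ‖G m t‖ = ‖G m τ - (G m τ - G m t)‖ := by rw [sub_sub_cancel]
    _ ≤ ‖G m τ‖ + ‖G m τ - G m t‖ := norm_sub_le _ _
    _ ≤ _ := by
      gcongr
      refine hmv.trans ?_
      have := hB0 (m + 1)
      gcongr
      linarith

/-- A function on `(0, τ)` with bounded derivative has a limit at `0`. -/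
theorem exists_tendsto_nhdsGT_zero_of_norm_deriv_le {E : Type*} [NormedAddCommGroup E]
    [NormedSpace ℝ E] [CompleteSpace E] {u u' : ℝ → E} {B τ : ℝ} (hτ : 0 < τ)
    (hu : ∀ s, 0 < s → s < τ → HasDerivAt u (u' s) s)
    (hB : ∀ s, 0 < s → s < τ → ‖u' s‖ ≤ B) :
    ∃ l, Tendsto u (nhdsWithin 0 (Set.Ioi 0)) (nhds l) := by
  have hlip : LipschitzOnWith B.toNNReal u (Set.Ioo 0 τ) :=
    (convex_Ioo 0 τ).lipschitzOnWith_of_nnnorm_hasDerivWithin_le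
      (fun s hs ↦ (hu s hs.1 hs.2).hasDerivWithinAt)
      (fun s hs ↦ by
        rw [← NNReal.coe_le_coe, coe_nnnorm]
        exact (hB s hs.1 hs.2).trans (Real.le_coe_toNNReal B))
  have hc : Cauchy (nhdsWithin (0 : ℝ) (Set.Ioi 0)) :=
    cauchy_nhds.mono nhdsWithin_le_nhds
  refine CompleteSpace.complete ?_
  have hmem := prod_mem_prod (Ioo_mem_nhdsGT hτ) (Ioo_mem_nhdsGT hτ)
  exact cauchy_map_iff.2 ⟨hc.1, hlip.uniformContinuousOn.mono_left
    (le_inf hc.2 (le_principal_iff.2 hmem))⟩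

/-- Weighted `L¹` norms of Schwartz functions are dominated by a continuous seminorm. -/
theorem SchwartzMap.exists_continuous_seminorm_integral_le {E : Type*} [NormedAddCommGroup E]
    [NormedSpace ℝ E] [FiniteDimensional ℝ E] [MeasurableSpace E] [BorelSpace E]
    (μ : Measure E) [μ.IsAddHaarMeasure] (N : ℕ) :
    ∃ p : Seminorm ℂ (SchwartzMap E ℂ), Continuous p ∧ ∀ f : SchwartzMap E ℂ,
      Integrable (fun x ↦ (1 + ‖x‖) ^ N * ‖f x‖) μ ∧ ∫ x, (1 + ‖x‖) ^ N * ‖f x‖ ∂μ ≤ p f := by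
  let D := Module.finrank ℝ E + 1
  let w : E → ℝ := fun x ↦ (1 + ‖x‖) ^ (-(D : ℝ))
  have hw : Integrable w μ := integrable_one_add_norm (by simp [D])
  have hw0 : 0 ≤ ∫ x, w x ∂μ := integral_nonneg fun x ↦ by positivity
  let m : ℕ × ℕ := (N + D, 0)
  let q : Seminorm ℂ (SchwartzMap E ℂ) :=
    (Finset.Iic m).sup (schwartzSeminormFamily ℂ E ℂ)
  have hq : Continuous q := Seminorm.continuous_finsetSup fun i _ ↦
    (schwartz_withSeminorms ℂ E ℂ).continuous_seminorm i
  let c : NNReal := ⟨(∫ x, w x ∂μ) * 2 ^ (N + D), by positivity⟩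
  have hpt (f : SchwartzMap E ℂ) (x : E) :
      (1 + ‖x‖) ^ N * ‖f x‖ ≤ w x * (2 ^ (N + D) * q f) := by
    have h := SchwartzMap.one_add_le_sup_seminorm_apply (𝕜 := ℂ) (m := m) (k := N + D) (n := 0)
      le_rfl le_rfl f x
    rw [norm_iteratedFDeriv_zero] at h
    have hx : (0 : ℝ) < 1 + ‖x‖ := by positivity
    simp only [w]
    rw [Real.rpow_neg hx.le, Real.rpow_natCast, inv_mul_eq_div, le_div_iff₀ (by positivity)]
    refine le_trans (le_of_eq ?_) h
    ring
  have hint (f : SchwartzMap E ℂ) : Integrable (fun x ↦ (1 + ‖x‖) ^ N * ‖f x‖) μ := by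
    refine (hw.mul_const (2 ^ (N + D) * q f)).mono' ?_ (.of_forall fun x ↦ ?_)
    · have := f.continuous
      exact Continuous.aestronglyMeasurable (by fun_prop)
    · rw [Real.norm_of_nonneg (by positivity)]
      exact hpt f x
  refine ⟨c • q, ?_, fun f ↦ ⟨hint f, ?_⟩⟩
  · exact hq.const_smul c
  · refine (integral_mono (hint f) (hw.mul_const _) (hpt f)).trans (le_of_eq ?_)
    rw [integral_mul_const, ← mul_assoc]
    rfl

/-- Cauchy estimate for a function on a horizontal strip. -/
theorem norm_deriv_le_of_strip {E : Type*} [NormedAddCommGroup E] {γ : E → ℂ → ℂ} {δ M : ℝ}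
    {N m : ℕ}
    (hd : ∀ x, DifferentiableOn ℂ (γ x) {ζ | 0 < ζ.im ∧ ζ.im < δ})
    (hM : 0 ≤ M)
    (hb : ∀ x ζ, 0 < ζ.im → ζ.im < δ → |ζ.re| ≤ δ → ‖γ x ζ‖ ≤ M * (1 + ‖x‖) ^ N / ζ.im ^ m)
    {r t : ℝ} (hr : 0 < r) (hrt : 2 * r ≤ t) (htδ : t + r < δ) (x : E) :
    ‖deriv (γ x) (t * I)‖ ≤ M / r ^ m / r * (1 + ‖x‖) ^ N := by
  have him (z : ℂ) (hz : z ∈ Metric.closedBall (t * I : ℂ) r) : |z.re| ≤ r ∧ |z.im - t| ≤ r := by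
    rw [mem_closedBall_iff_norm] at hz
    have h1 := (abs_re_le_norm (z - t * I)).trans hz
    have h2 := (abs_im_le_norm (z - t * I)).trans hz
    simp at h1 h2
    exact ⟨h1, h2⟩
  have hle : ‖deriv (γ x) (t * I)‖ ≤ M * (1 + ‖x‖) ^ N / r ^ m / r := by
    refine norm_deriv_le_of_forall_mem_sphere_norm_le hr ?_ fun z hz ↦ ?_
    · refine ((hd x).mono fun z hz ↦ ?_).diffContOnCl_ball subset_rfl
      obtain ⟨-, h⟩ := him z hz
      rw [abs_le] at h
      constructor <;> linarith [h.1, h.2]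
    · obtain ⟨h1, h2⟩ := him z (Metric.sphere_subset_closedBall hz)
      rw [abs_le] at h2
      have hrz : r ≤ z.im := by linarith [h2.1]
      refine (hb x z (by linarith) (by linarith [h2.2]) (by linarith)).trans ?_
      gcongr
  refine hle.trans (le_of_eq ?_)
  ring

theorem hasDerivAt_of_strip {E : Type*} {γ : E → ℂ → ℂ} {δ : ℝ}
    (hd : ∀ x, DifferentiableOn ℂ (γ x) {ζ | 0 < ζ.im ∧ ζ.im < δ})
    (x : E) {ζ : ℂ} (h0 : 0 < ζ.im) (h1 : ζ.im < δ) :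
    HasDerivAt (γ x) (deriv (γ x) ζ) ζ := by
  have hopen : IsOpen {ζ : ℂ | 0 < ζ.im ∧ ζ.im < δ} :=
    (isOpen_lt continuous_const continuous_im).inter (isOpen_lt continuous_im continuous_const)
  exact ((hd x).differentiableAt (hopen.mem_nhds ⟨h0, h1⟩)).hasDerivAt

section TubeFamily

variable {E : Type*} [NormedAddCommGroup E] [NormedSpace ℝ E] [FiniteDimensional ℝ E]
  [MeasurableSpace E] [BorelSpace E] {μ : Measure E} [μ.IsAddHaarMeasure]
  {v : E} {γ : E → ℂ → ℂ} {δ M : ℝ} {N m : ℕ}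

theorem integrable_mul_schwartzMap_of_norm_le {h : E → ℂ} {B : ℝ}
    (hm : AEStronglyMeasurable h μ) (hb : ∀ x, ‖h x‖ ≤ B * (1 + ‖x‖) ^ N)
    (f : SchwartzMap E ℂ) : Integrable (fun x ↦ h x * f x) μ := by
  obtain ⟨p, -, hp⟩ := SchwartzMap.exists_continuous_seminorm_integral_le μ N
  refine ((hp f).1.const_mul B).mono' (hm.mul f.continuous.aestronglyMeasurable)
    (.of_forall fun x ↦ ?_)
  rw [norm_mul, ← mul_assoc]
  gcongr
  exact hb x

/-- Differentiating the pairing of a holomorphic family with a Schwartz function in the imaginary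
direction amounts to differentiating the Schwartz function in a real direction. -/
theorem hasDerivAt_integral_mul_schwartzMap
    (hd : ∀ x, DifferentiableOn ℂ (γ x) {ζ | 0 < ζ.im ∧ ζ.im < δ})
    (htr : ∀ x (s : ℝ) ζ, γ (x + s • v) ζ = γ x (ζ + s))
    (hc : ∀ ζ : ℂ, 0 < ζ.im → ζ.im < δ → Continuous fun x ↦ γ x ζ)
    (hM : 0 ≤ M)
    (hb : ∀ x ζ, 0 < ζ.im → ζ.im < δ → |ζ.re| ≤ δ → ‖γ x ζ‖ ≤ M * (1 + ‖x‖) ^ N / ζ.im ^ m)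
    (f : SchwartzMap E ℂ) {t : ℝ} (ht0 : 0 < t) (htδ : t < δ) :
    HasDerivAt (fun s : ℝ ↦ ∫ x, γ x (s * I) * f x ∂μ)
      (∫ x, γ x (t * I) * ((-I) • LineDeriv.lineDerivOp v f : SchwartzMap E ℂ) x ∂μ) t := by
  have hbt (s : ℝ) (h0 : 0 < s) (h1 : s < δ) (x : E) :
      ‖γ x (s * I)‖ ≤ M / s ^ m * (1 + ‖x‖) ^ N := by
    have := hb x (s * I) (by simpa) (by simpa) (by simpa using (h0.trans h1).le)
    refine this.trans (le_of_eq ?_)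
    simp
    ring
  have hct (s : ℝ) (h0 : 0 < s) (h1 : s < δ) : Continuous fun x ↦ γ x (s * I) :=
    hc _ (by simpa) (by simpa)
  have hint (s : ℝ) (h0 : 0 < s) (h1 : s < δ) (f : SchwartzMap E ℂ) :
      Integrable (fun x ↦ γ x (s * I) * f x) μ :=
    integrable_mul_schwartzMap_of_norm_le (hct s h0 h1).aestronglyMeasurable (hbt s h0 h1) f
  obtain ⟨r, hr, hr1, hr2⟩ : ∃ r : ℝ, 0 < r ∧ 3 * r ≤ t ∧ t + 2 * r < δ := by
    refine ⟨min (t / 3) ((δ - t) / 3), lt_min (by linarith) (by linarith), ?_, ?_⟩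
    · linarith [min_le_left (t / 3) ((δ - t) / 3)]
    · linarith [min_le_right (t / 3) ((δ - t) / 3)]
  have hball (s : ℝ) (hs : s ∈ Metric.ball t r) : 2 * r ≤ s ∧ s + r < δ := by
    rw [Metric.mem_ball, Real.dist_eq, abs_lt] at hs
    constructor <;> linarith [hs.1, hs.2]
  have hdb (s : ℝ) (hs : s ∈ Metric.ball t r) (x : E) :
      ‖deriv (γ x) (s * I)‖ ≤ M / r ^ m / r * (1 + ‖x‖) ^ N :=
    norm_deriv_le_of_strip hd hM hb hr (hball s hs).1 (hball s hs).2 x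
  have hdγ (s : ℝ) (h0 : 0 < s) (h1 : s < δ) (x : E) :
      HasDerivAt (γ x) (deriv (γ x) (s * I)) (s * I) :=
    hasDerivAt_of_strip hd x (by simpa) (by simpa)
  have hline (x : E) : HasLineDerivAt ℝ (fun y ↦ γ y (t * I)) (deriv (γ x) (t * I)) x v := by
    have h2 : HasDerivAt (fun s : ℝ ↦ (t * I + s : ℂ)) 1 0 :=
      (Complex.ofRealCLM.hasDerivAt (x := 0)).const_add (t * I : ℂ)
    have h1 : HasDerivAt (γ x) (deriv (γ x) (t * I)) (t * I + (0 : ℝ)) := by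
      simpa using hdγ t ht0 htδ x
    have h3 := h1.comp (0 : ℝ) h2
    simp only [mul_one] at h3
    refine HasDerivAt.congr_of_eventuallyEq h3 (.of_forall fun s ↦ ?_)
    exact htr x s (t * I)
  have hmeas : AEStronglyMeasurable (fun x ↦ deriv (γ x) (t * I)) μ := by
    refine aestronglyMeasurable_of_tendsto_ae (nhdsWithin (0 : ℝ) (Set.Ioi 0))
      (f := fun s x ↦ s⁻¹ • (γ (x + s • v) (t * I) - γ x (t * I))) (fun s ↦ ?_)
      (.of_forall fun x ↦ ?_)
    · have := hct t ht0 htδ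
      exact Continuous.aestronglyMeasurable (by fun_prop)
    · exact (hasLineDerivAt_iff_tendsto_slope_zero.1 (hline x)).mono_left
        (nhdsWithin_mono _ fun s hs ↦ (ne_of_gt hs : s ≠ 0))
  have hmain := hasDerivAt_integral_of_dominated_loc_of_deriv_le (μ := μ) (𝕜 := ℝ)
    (F := fun s x ↦ γ x (s * I) * f x) (F' := fun s x ↦ I * (deriv (γ x) (s * I) * f x))
    (bound := fun x ↦ M / r ^ m / r * ((1 + ‖x‖) ^ N * ‖f x‖)) (x₀ := t)
    (Metric.ball_mem_nhds t hr)
    (by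
      filter_upwards [Ioo_mem_nhds ht0 htδ] with s hs
      exact (hint s hs.1 hs.2 f).aestronglyMeasurable)
    (hint t ht0 htδ f)
    ((hmeas.mul f.continuous.aestronglyMeasurable).const_mul I)
    (.of_forall fun x s hs ↦ by
      rw [norm_mul, norm_I, one_mul, norm_mul, ← mul_assoc]
      gcongr
      exact hdb s hs x)
    (by
      obtain ⟨p, -, hp⟩ := SchwartzMap.exists_continuous_seminorm_integral_le μ N
      exact (hp f).1.const_mul _)
    (.of_forall fun x s hs ↦ by
      have hs' := hball s hs
      have h2 : HasDerivAt (fun s : ℝ ↦ (s * I : ℂ)) I s := by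
        simpa using (Complex.ofRealCLM.hasDerivAt (x := s)).mul_const I
      have h3 := ((hdγ s (by linarith) (by linarith) x).comp s h2).mul_const (f x)
      exact h3.congr_deriv (by ring))
  refine hmain.2.congr_deriv ?_
  have hparts := integral_bilinear_hasLineDerivAt_right_eq_neg_left_of_integrable (μ := μ)
    (B := ContinuousLinearMap.mul ℝ ℂ) (f := fun x ↦ γ x (t * I))
    (f' := fun x ↦ deriv (γ x) (t * I)) (g := f)
    (g' := (LineDeriv.lineDerivOp v f : SchwartzMap E ℂ)) (v := v)
    (integrable_mul_schwartzMap_of_norm_le hmeas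
      (hdb t (Metric.mem_ball_self hr)) f)
    (hint t ht0 htδ _) (hint t ht0 htδ f) (fun x _ ↦ hline x)
    (fun x _ ↦ by
      rw [SchwartzMap.lineDerivOp_apply_eq_fderiv]
      exact f.differentiableAt.hasFDerivAt.hasLineDerivAt v)
  simp only [ContinuousLinearMap.mul_apply'] at hparts
  have hneg := neg_eq_iff_eq_neg.2 hparts
  rw [integral_const_mul, ← hneg, mul_neg, ← neg_mul, ← integral_const_mul]
  congr 1 with x
  rw [smul_apply, smul_eq_mul]
  ring

/-- Boundary values of a holomorphic family of polynomial growth define a tempered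
distribution. -/
theorem exists_schwartzMap_clm_tendsto_integral (hδ : 0 < δ)
    (hd : ∀ x, DifferentiableOn ℂ (γ x) {ζ | 0 < ζ.im ∧ ζ.im < δ})
    (htr : ∀ x (s : ℝ) ζ, γ (x + s • v) ζ = γ x (ζ + s))
    (hc : ∀ ζ : ℂ, 0 < ζ.im → ζ.im < δ → Continuous fun x ↦ γ x ζ)
    (hM : 0 ≤ M)
    (hb : ∀ x ζ, 0 < ζ.im → ζ.im < δ → |ζ.re| ≤ δ → ‖γ x ζ‖ ≤ M * (1 + ‖x‖) ^ N / ζ.im ^ m) :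
    ∃ T : SchwartzMap E ℂ →L[ℂ] ℂ, ∀ f : SchwartzMap E ℂ,
      Tendsto (fun t : ℝ ↦ ∫ x, γ x (t * I) * f x ∂μ) (nhdsWithin 0 (Set.Ioi 0)) (nhds (T f)) := by
  have hbt (s : ℝ) (h0 : 0 < s) (h1 : s < δ) (x : E) :
      ‖γ x (s * I)‖ ≤ M / s ^ m * (1 + ‖x‖) ^ N := by
    have := hb x (s * I) (by simpa) (by simpa) (by simpa using (h0.trans h1).le)
    refine this.trans (le_of_eq ?_)
    simp
    ring
  have hint (s : ℝ) (h0 : 0 < s) (h1 : s < δ) (f : SchwartzMap E ℂ) :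
      Integrable (fun x ↦ γ x (s * I) * f x) μ :=
    integrable_mul_schwartzMap_of_norm_le (hc _ (by simpa) (by simpa)).aestronglyMeasurable
      (hbt s h0 h1) f
  obtain ⟨p, hpc, hp⟩ := SchwartzMap.exists_continuous_seminorm_integral_le μ N
  let F (f : SchwartzMap E ℂ) (t : ℝ) : ℂ := ∫ x, γ x (t * I) * f x ∂μ
  let A : SchwartzMap E ℂ →L[ℂ] SchwartzMap E ℂ :=
    (-I) • LineDeriv.lineDerivOpCLM ℂ (SchwartzMap E ℂ) v
  have hF (f : SchwartzMap E ℂ) (s : ℝ) (h0 : 0 < s) (h1 : s < δ) :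
      HasDerivAt (F f) (F (A f) s) s :=
    hasDerivAt_integral_mul_schwartzMap hd htr hc hM hb f h0 h1
  have hFp (f : SchwartzMap E ℂ) (s : ℝ) (h0 : 0 < s) (h1 : s < δ) :
      ‖F f s‖ ≤ M * p f / s ^ m := by
    calc ‖F f s‖ ≤ ∫ x, M / s ^ m * ((1 + ‖x‖) ^ N * ‖f x‖) ∂μ := by
          refine norm_integral_le_of_norm_le ((hp f).1.const_mul _) (.of_forall fun x ↦ ?_)
          rw [norm_mul, ← mul_assoc]
          gcongr
          exact hbt s h0 h1 x
      _ ≤ M / s ^ m * p f := by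
          rw [integral_const_mul]
          gcongr
          exact (hp f).2
      _ = _ := by ring
  let τ := δ / 2
  have hτ0 : 0 < τ := half_pos hδ
  have hτ : τ < δ := half_lt_self hδ
  let q (f : SchwartzMap E ℂ) : ℝ :=
    ∑ j ∈ Finset.range (m + 1), M * p ((A ^ j) f) / τ ^ m * τ ^ j + M * p ((A ^ (m + 1)) f) * τ
  have hFq (f : SchwartzMap E ℂ) (t : ℝ) (h0 : 0 < t) (h1 : t ≤ τ) : ‖F f t‖ ≤ q f := by
    refine norm_le_of_hasDerivAt_of_norm_le_div_pow (u := fun j ↦ F ((A ^ j) f))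
      (B := fun j ↦ M * p ((A ^ j) f)) (fun j s h0 h1 ↦ ?_) (fun j ↦ hFp _) hτ h0 h1
    rw [pow_succ']
    exact hF _ s h0 h1
  have hlim (f : SchwartzMap E ℂ) :
      ∃ l, Tendsto (F f) (nhdsWithin 0 (Set.Ioi 0)) (nhds l) :=
    exists_tendsto_nhdsGT_zero_of_norm_deriv_le hτ0 (fun s h0 h1 ↦ hF f s h0 (h1.trans hτ))
      (fun s h0 h1 ↦ hFq (A f) s h0 h1.le)
  choose T hT using hlim
  have hev : ∀ᶠ t in nhdsWithin (0 : ℝ) (Set.Ioi 0), 0 < t ∧ t < τ := Ioo_mem_nhdsGT hτ0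
  let Tlin : SchwartzMap E ℂ →ₗ[ℂ] ℂ :=
    { toFun := T
      map_add' := fun f f' ↦ by
        refine tendsto_nhds_unique (hT (f + f')) (((hT f).add (hT f')).congr' ?_)
        filter_upwards [hev] with t ht
        have h1 := ht.2.trans hτ
        simp only [F]
        rw [← integral_add (hint t ht.1 h1 f) (hint t ht.1 h1 f')]
        simp only [add_apply, mul_add]
      map_smul' := fun c f ↦ by
        refine tendsto_nhds_unique (hT (c • f)) (((hT f).const_smul c).congr fun t ↦ ?_)
        simp only [F]
        rw [← integral_smul]
        congr 1 with x
        simp only [smul_apply, smul_eq_mul]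
        ring }
  have hTq (f : SchwartzMap E ℂ) : ‖T f‖ ≤ q f := by
    refine le_of_tendsto (hT f).norm ?_
    filter_upwards [hev] with t ht
    exact hFq f t ht.1 ht.2.le
  have hqc : Continuous q := by
    have h (j : ℕ) : Continuous fun f ↦ p ((A ^ j) f) := hpc.comp (A ^ j).continuous
    fun_prop
  have hq0 : q 0 = 0 := by simp [q]
  have hTc : Continuous Tlin := by
    refine continuous_of_continuousAt_zero Tlin ?_
    rw [ContinuousAt, map_zero]
    refine squeeze_zero_norm hTq ?_
    simpa [hq0] using hqc.tendsto 0
  exact ⟨⟨Tlin, hTc⟩, hT⟩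

end TubeFamily

/-- **Vladimirov's theorem on tube domains: existence of the boundary value as a tempered
distribution.** Let `V ⊆ ℝ^d` be an open convex cone (vertex 0, not containing 0), and let
`g` be holomorphic on `W = {x+iy : y ∈ V, ‖y‖ < a}` with
`|g(x+iy)| ≤ C (1+‖x‖²)^L ‖y‖^{-2K}`. Then for every `v ∈ V` the boundary value
`f ↦ lim_{ε→0+} ∫ g(x+iεv) f(x) dx` exists on Schwartz functions and defines a tempered
distribution. -/
theorem tube_domain_boundary_value_is_tempered_distribution
    (d : ℕ) (hd : 1 ≤ d)
    (V : Set (Fin d → ℝ))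
    (hVopen : IsOpen V) (hVne : V.Nonempty) (hV0 : (0 : Fin d → ℝ) ∉ V)
    (hVcone : ∀ y ∈ V, ∀ y' ∈ V, ∀ l m : ℝ, 0 < l → 0 < m → l • y + m • y' ∈ V)
    (a : ℝ) (ha : 0 < a)
    (g : (Fin d → ℂ) → ℂ)
    (hg : DifferentiableOn ℂ g
      {z : Fin d → ℂ | (fun k => (z k).im) ∈ V ∧ Real.sqrt (∑ k, (z k).im ^ 2) < a})
    (C : ℝ) (hC : 0 < C) (L K : ℕ)
    (hbound : ∀ z : Fin d → ℂ,
      (fun k => (z k).im) ∈ V → Real.sqrt (∑ k, (z k).im ^ 2) < a →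
      ‖g z‖ ≤ C * (1 + ∑ k, (z k).re ^ 2) ^ L / (∑ k, (z k).im ^ 2) ^ K) :
    ∀ v ∈ V, ∃ T : SchwartzMap (Fin d → ℝ) ℂ →L[ℂ] ℂ,
      ∀ f : SchwartzMap (Fin d → ℝ) ℂ,
        Tendsto
          (fun ε : ℝ => ∫ x : Fin d → ℝ,
            g (fun k => (x k : ℂ) + (ε * v k : ℝ) * Complex.I) * f x)
          (nhdsWithin 0 (Set.Ioi 0)) (nhds (T f)) := by
  intro v hv
  let S : ℝ := ∑ k, v k ^ 2
  have hS : 0 < S := by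
    refine (Finset.sum_nonneg fun k _ ↦ sq_nonneg (v k)).lt_of_ne' fun h ↦ ?_
    rw [Finset.sum_eq_zero_iff_of_nonneg fun k _ ↦ sq_nonneg (v k)] at h
    have hv0 : v = 0 := funext fun k ↦ pow_eq_zero_iff two_ne_zero |>.1 (h k (Finset.mem_univ k))
    exact hV0 (hv0 ▸ hv)
  let δ : ℝ := a / Real.sqrt S
  have hδ : 0 < δ := by positivity
  let P (x : Fin d → ℝ) (ζ : ℂ) : Fin d → ℂ := fun k ↦ (x k : ℂ) + ζ * v k
  have hre (x : Fin d → ℝ) (ζ : ℂ) (k : Fin d) : (P x ζ k).re = x k + ζ.re * v k := by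
    simp [P]
  have him (x : Fin d → ℝ) (ζ : ℂ) (k : Fin d) : (P x ζ k).im = ζ.im * v k := by
    simp [P]
  have hsum (x : Fin d → ℝ) (ζ : ℂ) : ∑ k, (P x ζ k).im ^ 2 = ζ.im ^ 2 * S := by
    simp only [him, mul_pow, S, Finset.mul_sum]
  have hmemV (x : Fin d → ℝ) (ζ : ℂ) (h0 : 0 < ζ.im) : (fun k ↦ (P x ζ k).im) ∈ V := by
    have h := hVcone v hv v hv (ζ.im / 2) (ζ.im / 2) (half_pos h0) (half_pos h0)
    rw [← add_smul, add_halves] at h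
    simpa only [him] using! h
  have hlt (x : Fin d → ℝ) (ζ : ℂ) (h0 : 0 < ζ.im) (h1 : ζ.im < δ) :
      Real.sqrt (∑ k, (P x ζ k).im ^ 2) < a := by
    rw [hsum, Real.sqrt_mul (sq_nonneg _), Real.sqrt_sq h0.le]
    exact (lt_div_iff₀ (Real.sqrt_pos.2 hS)).1 h1
  obtain ⟨T, hT⟩ := exists_schwartzMap_clm_tendsto_integral (μ := (volume : Measure (Fin d → ℝ)))
    (v := v) (γ := fun x ζ ↦ g (P x ζ)) (δ := δ)
    (M := C * ((d + 1) * (1 + δ * ‖v‖) ^ 2) ^ L / S ^ K) (N := 2 * L) (m := 2 * K) hδ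
    (fun x ↦ hg.comp (by fun_prop) fun ζ hζ ↦ ⟨hmemV x ζ hζ.1, hlt x ζ hζ.1 hζ.2⟩)
    (fun x s ζ ↦ by
      simp only [P]
      congr 1 with k
      simp
      ring)
    (fun ζ h0 h1 ↦ hg.continuousOn.comp_continuous (by fun_prop)
      fun x ↦ ⟨hmemV x ζ h0, hlt x ζ h0 h1⟩)
    (by positivity)
    (fun x ζ h0 h1 hζ ↦ by
      have hpt : 1 + ∑ k, (P x ζ k).re ^ 2 ≤ (d + 1) * (1 + δ * ‖v‖) ^ 2 * (1 + ‖x‖) ^ 2 := by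
        have hk (k : Fin d) : (P x ζ k).re ^ 2 ≤ ((1 + δ * ‖v‖) * (1 + ‖x‖)) ^ 2 := by
          rw [hre]
          refine sq_le_sq' ?_ ?_
          all_goals
            have hx := abs_le.1 (norm_le_pi_norm x k)
            have hv : |ζ.re * v k| ≤ δ * ‖v‖ := by
              rw [abs_mul]
              exact mul_le_mul hζ (norm_le_pi_norm v k) (abs_nonneg _) hδ.le
            have hv' := abs_le.1 hv
            have hprod : 0 ≤ δ * ‖v‖ * ‖x‖ := by positivity
            nlinarith [hx.1, hx.2, hv'.1, hv'.2]
        have h1 : (1 : ℝ) ≤ ((1 + δ * ‖v‖) * (1 + ‖x‖)) ^ 2 := by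
          refine one_le_pow₀ (one_le_mul_of_one_le_of_one_le ?_ ?_)
          · have : 0 ≤ δ * ‖v‖ := by positivity
            linarith
          · linarith [norm_nonneg x]
        have h2 := Finset.sum_le_card_nsmul Finset.univ _ _ fun k _ ↦ hk k
        simp only [Finset.card_univ, Fintype.card_fin, nsmul_eq_mul] at h2
        nlinarith
      refine (hbound _ (hmemV x ζ h0) (hlt x ζ h0 h1)).trans ?_
      rw [hsum]
      calc C * (1 + ∑ k, (P x ζ k).re ^ 2) ^ L / (ζ.im ^ 2 * S) ^ K
          ≤ C * ((d + 1) * (1 + δ * ‖v‖) ^ 2 * (1 + ‖x‖) ^ 2) ^ L / (ζ.im ^ 2 * S) ^ K := by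
            gcongr
        _ = _ := by
            rw [mul_pow _ ((1 + ‖x‖) ^ 2), mul_pow (ζ.im ^ 2), ← pow_mul (1 + ‖x‖),
              ← pow_mul ζ.im]
            field_simp)
  refine ⟨T, fun f ↦ (hT f).congr fun ε ↦ ?_⟩
  congr 1 with x
  congr 2 with k
  simp only [P]
  push_cast
  ring
end

section
/- Let d ≥ 1, let V ⊆ ℝ^d be an open convex cone with vertex at 0 not containing 0, and let a > 0. Let g : ℂ^d → ℂ be holomorphic on W = {x + iy ∈ ℂ^d : y ∈ V, ‖y‖ < a} with |g(x+iy)| ≤ C (1 + ‖x‖^2)^L ‖y‖^{-2K} on W for some C > 0 and nonnegative integers L, K. Then for any two vectors v₁, v₂ ∈ V and every Schwartz function f : ℝ^d → ℂ, lim_{ε→0+} ∫_{ℝ^d} g(x + iεv₁) f(x) dx = lim_{ε→0+} ∫_{ℝ^d} g(x + iεv₂) f(x) dx; that is, the distributional boundary value of g on ℝ^d is independent of the direction of approach within the cone V. -/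
open MeasureTheory Filter Complex

open scoped Topology LineDeriv SchwartzMap

section TubeBoundaryValue

variable {d : ℕ}

/-- The point `x + iy` of `ℂ^d`. -/
def tubePoint (x y : Fin d → ℝ) : Fin d → ℂ := fun k => (x k : ℂ) + (y k : ℝ) * I

/-- The integral of `f` against the slice `x ↦ g (x + iy)`. -/
noncomputable def slicePairing (g : (Fin d → ℂ) → ℂ) (f : 𝓢(Fin d → ℝ, ℂ)) (y : Fin d → ℝ) : ℂ :=
  ∫ x, g (tubePoint x y) * f x

lemma im_tubePoint (x y : Fin d → ℝ) : (fun k => (tubePoint x y k).im) = y := by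
  ext k; simp [tubePoint]

lemma re_tubePoint (x y : Fin d → ℝ) : (fun k => (tubePoint x y k).re) = x := by
  ext k; simp [tubePoint]

lemma tubePoint_add_smul (x y w : Fin d → ℝ) (l : ℂ) :
    tubePoint x y + l • (fun k => (w k : ℂ)) = tubePoint (x + l.re • w) (y + l.im • w) := by
  ext k
  apply Complex.ext <;> simp [tubePoint]

lemma continuous_tubePoint_left (y : Fin d → ℝ) : Continuous fun x => tubePoint x y := by
  unfold tubePoint; fun_prop

lemma isOpen_tube {U : Set (Fin d → ℝ)} (hU : IsOpen U) :
    IsOpen {z : Fin d → ℂ | (fun k => (z k).im) ∈ U} :=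
  hU.preimage (by fun_prop)

lemma SchwartzMap.integrable_one_add_norm_pow_mul (f : 𝓢(Fin d → ℝ, ℂ)) (N : ℕ) :
    Integrable fun x => (1 + ‖x‖) ^ N * ‖f x‖ := by
  simp only [add_comm (1 : ℝ), add_pow, one_pow, mul_one, Finset.sum_mul]
  refine integrable_finsetSum _ fun k _ => ?_
  refine ((f.integrable_pow_mul volume k).mul_const (N.choose k : ℝ)).congr ?_
  exact .of_forall fun x => by ring

variable {g : (Fin d → ℂ) → ℂ} {U : Set (Fin d → ℝ)} {M : ℝ} {N : ℕ}

lemma continuous_slice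
    (hg : DifferentiableOn ℂ g {z | (fun k => (z k).im) ∈ U}) {y : Fin d → ℝ} (hy : y ∈ U) :
    Continuous fun x => g (tubePoint x y) :=
  hg.continuousOn.comp_continuous (continuous_tubePoint_left y) fun x => by
    simpa [im_tubePoint] using hy

lemma integrable_slice_mul
    (hg : DifferentiableOn ℂ g {z | (fun k => (z k).im) ∈ U})
    (hM : ∀ x, ∀ y ∈ U, ‖g (tubePoint x y)‖ ≤ M * (1 + ‖x‖) ^ N)
    (f : 𝓢(Fin d → ℝ, ℂ)) {y : Fin d → ℝ} (hy : y ∈ U) :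
    Integrable fun x => g (tubePoint x y) * f x := by
  refine ((f.integrable_one_add_norm_pow_mul N).const_mul M).mono'
    (((continuous_slice hg hy).mul f.continuous).aestronglyMeasurable) (.of_forall fun x => ?_)
  rw [norm_mul, ← mul_assoc]
  exact mul_le_mul_of_nonneg_right (hM x y hy) (norm_nonneg _)

/-- Along complex lines through a point over `U`, `g` has derivatives of polynomial growth. -/
lemma exists_deriv_slice_bound (hU : IsOpen U)
    (hg : DifferentiableOn ℂ g {z | (fun k => (z k).im) ∈ U})
    (hM : ∀ x, ∀ y ∈ U, ‖g (tubePoint x y)‖ ≤ M * (1 + ‖x‖) ^ N)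
    {y : Fin d → ℝ} (hy : y ∈ U) (w : Fin d → ℝ) :
    ∃ r > 0, ∃ M', ∀ l ∈ Metric.ball (0 : ℂ) r, y + l.im • w ∈ U ∧ ∀ x,
      DifferentiableAt ℂ (fun l : ℂ => g (tubePoint x y + l • (fun k => (w k : ℂ)))) l ∧
      ‖deriv (fun l : ℂ => g (tubePoint x y + l • (fun k => (w k : ℂ)))) l‖
        ≤ M' * (1 + ‖x‖) ^ N := by
  have hnear : ∀ᶠ l : ℂ in 𝓝 0, y + l.im • w ∈ U := by
    have hc : Continuous fun l : ℂ => y + l.im • w := by fun_prop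
    exact hc.continuousAt.eventually (hU.mem_nhds (by simpa using hy))
  obtain ⟨R, hR, hRU⟩ := Metric.eventually_nhds_iff_ball.1 hnear
  have hdiff : ∀ x, ∀ l ∈ Metric.ball (0 : ℂ) R,
      DifferentiableAt ℂ (fun l : ℂ => g (tubePoint x y + l • (fun k => (w k : ℂ)))) l := by
    intro x l hl
    have hmem : tubePoint x y + l • (fun k => (w k : ℂ)) ∈
        {z : Fin d → ℂ | (fun k => (z k).im) ∈ U} := by
      rw [tubePoint_add_smul]
      simpa only [Set.mem_ofPred_eq, im_tubePoint] using hRU l hl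
    have h1 : DifferentiableAt ℂ g (tubePoint x y + l • (fun k => (w k : ℂ))) :=
      hg.differentiableAt ((isOpen_tube hU).mem_nhds hmem)
    exact h1.comp l (by fun_prop)
  have hM0 : 0 ≤ M := by simpa using (norm_nonneg _).trans (hM 0 y hy)
  have hsub : ∀ l ∈ Metric.ball (0 : ℂ) (R / 2),
      Metric.closedBall l (R / 4) ⊆ Metric.ball 0 R := fun l hl =>
    (Metric.closedBall_subset_ball (by linarith : R / 4 < R / 2)).trans
      (Metric.ball_subset_ball' (by rw [Metric.mem_ball] at hl; linarith))
  refine ⟨R / 2, by positivity, M * (1 + R * ‖w‖) ^ N / (R / 4), fun l hl => ?_⟩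
  have hlR : l ∈ Metric.ball (0 : ℂ) R := Metric.ball_subset_ball (by linarith) hl
  refine ⟨hRU l hlR, fun x => ⟨hdiff x l hlR, ?_⟩⟩
  rw [div_mul_eq_mul_div]
  refine norm_deriv_le_of_forall_mem_sphere_norm_le (by positivity) ?_ fun z hz => ?_
  · refine DifferentiableOn.diffContOnCl fun z hz => (hdiff x z ?_).differentiableWithinAt
    exact hsub l hl (Metric.closure_ball_subset_closedBall hz)
  · have hz' := hsub l hl (Metric.sphere_subset_closedBall hz)
    rw [tubePoint_add_smul, mul_assoc, ← mul_pow]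
    refine (hM _ _ (hRU z hz')).trans ?_
    gcongr
    have h1 : ‖x + z.re • w‖ ≤ ‖x‖ + R * ‖w‖ := by
      refine (norm_add_le _ _).trans ?_
      rw [norm_smul, Real.norm_eq_abs]
      gcongr
      exact (abs_re_le_norm z).trans (by simpa using (Metric.mem_ball.1 hz').le)
    nlinarith [norm_nonneg x, norm_nonneg w, mul_nonneg hR.le (norm_nonneg w),
      mul_nonneg (mul_nonneg hR.le (norm_nonneg w)) (norm_nonneg x)]

lemma hasDerivAt_slicePairing_zero (hU : IsOpen U)
    (hg : DifferentiableOn ℂ g {z | (fun k => (z k).im) ∈ U})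
    (hM : ∀ x, ∀ y ∈ U, ‖g (tubePoint x y)‖ ≤ M * (1 + ‖x‖) ^ N)
    (f : 𝓢(Fin d → ℝ, ℂ)) {y : Fin d → ℝ} (hy : y ∈ U) (w : Fin d → ℝ) :
    HasDerivAt (fun s : ℝ => slicePairing g f (y + s • w))
      (-I * slicePairing g (∂_{w} f) y) 0 := by
  obtain ⟨r, hr, M', hr'⟩ := exists_deriv_slice_bound hU hg hM hy w
  set h : (Fin d → ℝ) → ℂ → ℂ := fun x l => g (tubePoint x y + l • (fun k => (w k : ℂ))) with h_def
  have h0 : (0 : ℂ) ∈ Metric.ball (0 : ℂ) r := Metric.mem_ball_self hr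
  have hline : ∀ x, HasLineDerivAt ℝ (fun x => g (tubePoint x y)) (deriv (h x) 0) x w := by
    intro x
    have h1 : HasDerivAt (h x) (deriv (h x) 0) ((0 : ℝ) : ℂ) := by
      simpa using ((hr' 0 h0).2 x).1.hasDerivAt
    have h2 := h1.comp_ofReal
    refine HasDerivAt.congr_deriv (h2.congr_of_eventuallyEq (.of_forall fun t => ?_)) rfl
    simp [h_def, tubePoint_add_smul]
  have hslice : ∀ l ∈ Metric.ball (0 : ℂ) r, Continuous fun x => h x l := by
    intro l hl
    simp only [h_def, tubePoint_add_smul]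
    exact (continuous_slice hg (hr' l hl).1).comp (by fun_prop : Continuous fun x => x + l.re • w)
  have key := hasDerivAt_integral_of_dominated_loc_of_deriv_le (μ := volume) (𝕜 := ℂ)
    (F := fun l x => h x l * f x) (F' := fun l x => deriv (h x) l * f x) (x₀ := 0)
    (bound := fun x => M' * ((1 + ‖x‖) ^ N * ‖f x‖))
    (Metric.ball_mem_nhds (0 : ℂ) hr)
    (eventually_of_mem (Metric.ball_mem_nhds (0 : ℂ) hr) fun l hl =>
      ((hslice l hl).mul f.continuous).aestronglyMeasurable)
    (by simpa [h_def] using integrable_slice_mul hg hM f hy)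
    (by
      refine AEStronglyMeasurable.mul ?_ f.continuous.aestronglyMeasurable
      refine (aestronglyMeasurable_lineDeriv (𝕜 := ℝ) (v := w) (continuous_slice hg hy)
        volume).congr (.of_forall fun x => (hline x).lineDeriv))
    (.of_forall fun x l hl => by
      rw [norm_mul, ← mul_assoc]
      exact mul_le_mul_of_nonneg_right ((hr' l hl).2 x).2 (norm_nonneg _))
    ((f.integrable_one_add_norm_pow_mul N).const_mul M')
    (.of_forall fun x l hl => ((hr' l hl).2 x).1.hasDerivAt.mul_const _)
  have hparts : ∫ x, g (tubePoint x y) * (∂_{w} f) x = -∫ x, deriv (h x) 0 * f x :=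
    integral_bilinear_hasLineDerivAt_right_eq_neg_left_of_integrable
      (B := ContinuousLinearMap.mul ℝ ℂ) key.1 (integrable_slice_mul hg hM (∂_{w} f) hy)
      (integrable_slice_mul hg hM f hy) (fun x _ => hline x)
      (fun x _ => by
        rw [SchwartzMap.lineDerivOp_apply]
        exact f.differentiableAt.lineDifferentiableAt.hasLineDerivAt)
  have h3 : HasDerivAt (fun s : ℝ => (s : ℂ) * I) I 0 := by
    simpa using (hasDerivAt_id (0 : ℝ)).ofReal_comp.mul_const I
  have h4 := HasDerivAt.scomp_of_eq (g₁ := fun l => ∫ x, h x l * f x) (0 : ℝ) key.2 h3 (by simp)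
  refine HasDerivAt.congr_deriv (h4.congr_of_eventuallyEq (.of_forall fun s => ?_)) ?_
  · simp [slicePairing, h_def, tubePoint_add_smul]
  · simp [slicePairing, hparts]

lemma hasDerivAt_slicePairing (hU : IsOpen U)
    (hg : DifferentiableOn ℂ g {z | (fun k => (z k).im) ∈ U})
    (hM : ∀ x, ∀ y ∈ U, ‖g (tubePoint x y)‖ ≤ M * (1 + ‖x‖) ^ N)
    (f : 𝓢(Fin d → ℝ, ℂ)) {y w : Fin d → ℝ} {s : ℝ} (hy : y + s • w ∈ U) :
    HasDerivAt (fun s : ℝ => slicePairing g f (y + s • w))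
      (-I * slicePairing g (∂_{w} f) (y + s • w)) s := by
  have h := hasDerivAt_slicePairing_zero hU hg hM f hy w
  rw [← sub_self s] at h
  refine (h.comp_sub_const s s).congr_of_eventuallyEq (.of_forall fun t => ?_)
  simp only []
  congr 1
  module

lemma slicePairing_add
    (hg : DifferentiableOn ℂ g {z | (fun k => (z k).im) ∈ U})
    (hM : ∀ x, ∀ y ∈ U, ‖g (tubePoint x y)‖ ≤ M * (1 + ‖x‖) ^ N)
    (f h : 𝓢(Fin d → ℝ, ℂ)) {y : Fin d → ℝ} (hy : y ∈ U) :
    slicePairing g (f + h) y = slicePairing g f y + slicePairing g h y := by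
  simp only [slicePairing, add_apply, mul_add]
  exact integral_add (integrable_slice_mul hg hM f hy) (integrable_slice_mul hg hM h hy)

lemma slicePairing_smul (g : (Fin d → ℂ) → ℂ) (c : ℝ) (f : 𝓢(Fin d → ℝ, ℂ)) (y : Fin d → ℝ) :
    slicePairing g (c • f) y = c * slicePairing g f y := by
  simp only [slicePairing, smul_apply, real_smul, ← integral_const_mul]
  congr 1 with x
  ring

lemma norm_slicePairing_le (g : (Fin d → ℂ) → ℂ) {y : Fin d → ℝ}
    (hM : ∀ x, ‖g (tubePoint x y)‖ ≤ M * (1 + ‖x‖) ^ N) (f : 𝓢(Fin d → ℝ, ℂ)) :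
    ‖slicePairing g f y‖ ≤ M * ∫ x, (1 + ‖x‖) ^ N * ‖f x‖ := by
  rw [← integral_const_mul]
  refine norm_integral_le_of_norm_le ((f.integrable_one_add_norm_pow_mul N).const_mul M)
    (.of_forall fun x => ?_)
  rw [norm_mul, ← mul_assoc]
  exact mul_le_mul_of_nonneg_right (hM x) (norm_nonneg _)

/-- Integrating a power bound on the derivative down from `b`. -/
lemma norm_le_of_norm_deriv_le_rpow {φ φ' : ℝ → ℂ} {C q b : ℝ} (hq : q ≠ 0)
    (hφ : ∀ s ∈ Set.Ioc 0 b, HasDerivAt φ (φ' s) s)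
    (hb : ∀ s ∈ Set.Ioc 0 b, ‖φ' s‖ ≤ C * s ^ (-(q + 1))) {s : ℝ} (hs : s ∈ Set.Ioc 0 b) :
    ‖φ s‖ ≤ ‖φ b‖ + C / q * (s ^ (-q) - b ^ (-q)) := by
  have hpos : ∀ u ∈ Set.Icc s b, u ∈ Set.Ioc 0 b := fun u hu => ⟨hs.1.trans_le hu.1, hu.2⟩
  have hB : ∀ u ∈ Set.Icc s b,
      HasDerivAt (fun u => C / q * (s ^ (-q) - u ^ (-q))) (C * u ^ (-(q + 1))) u := by
    intro u hu
    have h := ((Real.hasDerivAt_rpow_const (p := -q) (Or.inl (hpos u hu).1.ne')).const_sub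
      (s ^ (-q))).const_mul (C / q)
    refine h.congr_deriv ?_
    rw [show -q - 1 = -(q + 1) by ring]
    field_simp
  have h := image_norm_le_of_norm_deriv_right_le_deriv_boundary' (f := fun u => φ u - φ s)
    (f' := φ') (a := s) (b := b) (B := fun u => C / q * (s ^ (-q) - u ^ (-q)))
    (B' := fun u => C * u ^ (-(q + 1)))
    (fun u hu => ((hφ u (hpos u hu)).continuousAt.sub continuousAt_const).continuousWithinAt)
    (fun u hu => ((hφ u (hpos u ⟨hu.1, hu.2.le⟩)).sub_const _).hasDerivWithinAt)
    (by simp) (fun u hu => (hB u hu).continuousAt.continuousWithinAt)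
    (fun u hu => (hB u ⟨hu.1, hu.2.le⟩).hasDerivWithinAt)
    (fun u hu => hb u (hpos u ⟨hu.1, hu.2.le⟩)) (Set.right_mem_Icc.2 hs.2)
  have h' := norm_sub_norm_le (φ s) (φ b)
  rw [norm_sub_rev] at h'
  linarith

section Segment

variable {v w : Fin d → ℝ} {b : ℝ}

/-- The pairings along the rays through the segment `v + t w`, `t ∈ [0, 1]`, grow at most like
`ε ^ (-q)` at the origin, uniformly in `t`. -/
def SliceGrowth (g : (Fin d → ℂ) → ℂ) (v w : Fin d → ℝ) (b q : ℝ) : Prop :=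
  ∀ f : 𝓢(Fin d → ℝ, ℂ), ∃ C, ∀ t ∈ Set.Icc (0 : ℝ) 1, ∀ s ∈ Set.Ioc 0 b,
    ‖slicePairing g f (s • (v + t • w))‖ ≤ C * s ^ (-q)

/-- On `U` the pairings are additive in the test function, and differentiating them in the
imaginary direction amounts to differentiating the test function. -/
structure HasSliceDeriv (g : (Fin d → ℂ) → ℂ) (U : Set (Fin d → ℝ)) : Prop where
  hasDerivAt : ∀ (f : 𝓢(Fin d → ℝ, ℂ)) (y w : Fin d → ℝ) (s : ℝ), y + s • w ∈ U →
    HasDerivAt (fun s : ℝ => slicePairing g f (y + s • w))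
      (-I * slicePairing g (∂_{w} f) (y + s • w)) s
  pairing_add : ∀ (f h : 𝓢(Fin d → ℝ, ℂ)), ∀ y ∈ U,
    slicePairing g (f + h) y = slicePairing g f y + slicePairing g h y

lemma slicePairing_lineDeriv_smul (g : (Fin d → ℂ) → ℂ) (f : 𝓢(Fin d → ℝ, ℂ)) (c : ℝ)
    (w y : Fin d → ℝ) : slicePairing g (∂_{c • w} f) y = c * slicePairing g (∂_{w} f) y := by
  rw [LineDeriv.lineDerivOp_left_smul, slicePairing_smul]

lemma hasDerivAt_slicePairing_ray (hreg : HasSliceDeriv g U)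
    (hseg : ∀ t ∈ Set.Icc (0 : ℝ) 1, ∀ s ∈ Set.Ioc 0 b, s • (v + t • w) ∈ U)
    (f : 𝓢(Fin d → ℝ, ℂ)) {t : ℝ} (ht : t ∈ Set.Icc (0 : ℝ) 1)
    {s : ℝ} (hs : s ∈ Set.Ioc 0 b) :
    HasDerivAt (fun s : ℝ => slicePairing g f (s • (v + t • w)))
      (-I * slicePairing g (∂_{v + t • w} f) (s • (v + t • w))) s := by
  simpa using hreg.hasDerivAt f 0 (v + t • w) s (by simpa using hseg t ht s hs)

lemma SliceGrowth.lineDeriv (hreg : HasSliceDeriv g U)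
    (hseg : ∀ t ∈ Set.Icc (0 : ℝ) 1, ∀ s ∈ Set.Ioc 0 b, s • (v + t • w) ∈ U)
    {q : ℝ} (hP : SliceGrowth g v w b q) (f : 𝓢(Fin d → ℝ, ℂ)) :
    ∃ C, ∀ t ∈ Set.Icc (0 : ℝ) 1, ∀ s ∈ Set.Ioc 0 b,
      ‖-I * slicePairing g (∂_{v + t • w} f) (s • (v + t • w))‖ ≤ C * s ^ (-q) := by
  obtain ⟨C₁, h₁⟩ := hP (∂_{v} f)
  obtain ⟨C₂, h₂⟩ := hP (∂_{w} f)
  refine ⟨C₁ + C₂, fun t ht s hs => ?_⟩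
  rw [LineDeriv.lineDerivOp_left_add, hreg.pairing_add _ _ _ (hseg t ht s hs), slicePairing_lineDeriv_smul,
    norm_mul, norm_neg, norm_I, one_mul, add_mul]
  refine (norm_add_le _ _).trans (add_le_add (h₁ t ht s hs) (le_trans ?_ (h₂ t ht s hs)))
  rw [norm_mul, norm_real, Real.norm_of_nonneg ht.1]
  exact mul_le_of_le_one_left (norm_nonneg _) ht.2

lemma SliceGrowth.improve (hreg : HasSliceDeriv g U)
    (hseg : ∀ t ∈ Set.Icc (0 : ℝ) 1, ∀ s ∈ Set.Ioc 0 b, s • (v + t • w) ∈ U)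
    (hb : 0 < b) (hb1 : b ≤ 1) {q : ℝ} (hq : q ≠ 0)
    (hP : SliceGrowth g v w b (q + 1)) : SliceGrowth g v w b (max q 0) := by
  intro f
  obtain ⟨C₀, h₀⟩ := hP f
  obtain ⟨C, hC⟩ := hP.lineDeriv hreg hseg f
  have hbb : b ∈ Set.Ioc 0 b := ⟨hb, le_rfl⟩
  have h01 : (0 : ℝ) ∈ Set.Icc (0 : ℝ) 1 := by simp
  have hCnn : 0 ≤ C := nonneg_of_mul_nonneg_left ((norm_nonneg _).trans (hC 0 h01 b hbb))
    (Real.rpow_pos_of_pos hb _)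
  have hA : 0 ≤ C₀ * b ^ (-(q + 1)) := (norm_nonneg _).trans (h₀ 0 h01 b hbb)
  refine ⟨C₀ * b ^ (-(q + 1)) + C / |q|, fun t ht s hs => ?_⟩
  have h := norm_le_of_norm_deriv_le_rpow hq
    (fun s hs => hasDerivAt_slicePairing_ray hreg hseg f ht hs) (hC t ht) hs
  have hone : 1 ≤ s ^ (-max q 0) :=
    Real.one_le_rpow_of_pos_of_le_one_of_nonpos hs.1 (hs.2.trans hb1) (by simp)
  have hmain : C / q * (s ^ (-q) - b ^ (-q)) ≤ C / |q| * s ^ (-max q 0) := by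
    rcases lt_or_gt_of_ne hq with hneg | hpos
    · rw [abs_of_neg hneg, max_eq_right hneg.le, neg_zero, Real.rpow_zero, mul_one,
        show C / q * (s ^ (-q) - b ^ (-q)) = C / -q * (b ^ (-q) - s ^ (-q)) by
          rw [div_neg]; ring]
      refine mul_le_of_le_one_right (div_nonneg hCnn (by linarith)) ?_
      have h1 : b ^ (-q) ≤ 1 := Real.rpow_le_one hb.le hb1 (by linarith)
      have h2 : 0 ≤ s ^ (-q) := Real.rpow_nonneg hs.1.le _
      linarith
    · rw [abs_of_pos hpos, max_eq_left hpos.le]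
      refine mul_le_mul_of_nonneg_left ?_ (by positivity)
      have := Real.rpow_nonneg hb.le (-q)
      linarith
  calc _ ≤ _ := h
    _ ≤ C₀ * b ^ (-(q + 1)) * s ^ (-max q 0) + C / |q| * s ^ (-max q 0) :=
      add_le_add ((h₀ t ht b hbb).trans (le_mul_of_one_le_right hA hone)) hmain
    _ = _ := by ring

lemma SliceGrowth.zero (hreg : HasSliceDeriv g U)
    (hseg : ∀ t ∈ Set.Icc (0 : ℝ) 1, ∀ s ∈ Set.Ioc 0 b, s • (v + t • w) ∈ U)
    (hb : 0 < b) (hb1 : b ≤ 1) (n : ℕ)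
    (hP : SliceGrowth g v w b (n + 1 / 2)) : SliceGrowth g v w b 0 := by
  induction n with
  | zero =>
    have h := SliceGrowth.improve (q := -(1 / 2)) hreg hseg hb hb1 (by norm_num)
      (by convert hP using 1; norm_num)
    rwa [max_eq_right (by norm_num)] at h
  | succ n ih =>
    have hq : (0 : ℝ) < n + 1 / 2 := by positivity
    have h := SliceGrowth.improve (q := n + 1 / 2) hreg hseg hb hb1 hq.ne'
      (by convert hP using 1; push_cast; ring)
    rw [max_eq_left hq.le] at h
    exact ih h

lemma exists_tendsto_ray (hreg : HasSliceDeriv g U)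
    (hseg : ∀ t ∈ Set.Icc (0 : ℝ) 1, ∀ s ∈ Set.Ioc 0 b, s • (v + t • w) ∈ U)
    (hb : 0 < b) (hP : SliceGrowth g v w b 0) (f : 𝓢(Fin d → ℝ, ℂ)) :
    ∃ l, Tendsto (fun s : ℝ => slicePairing g f (s • v)) (𝓝[>] 0) (𝓝 l) := by
  obtain ⟨C, hC⟩ := hP.lineDeriv hreg hseg f
  have h01 : (0 : ℝ) ∈ Set.Icc (0 : ℝ) 1 := by simp
  have hlip : ∀ s ∈ Set.Ioc 0 b, ∀ u ∈ Set.Ioc 0 b,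
      ‖slicePairing g f (u • v) - slicePairing g f (s • v)‖ ≤ C * ‖u - s‖ := fun s hs u hu => by
    simpa using (convex_Ioc (0 : ℝ) b).norm_image_sub_le_of_norm_hasDerivWithin_le
      (fun x hx => (hasDerivAt_slicePairing_ray hreg hseg f h01 hx).hasDerivWithinAt)
      (fun x hx => by simpa using hC 0 h01 x hx) hs hu
  have huc : UniformContinuousOn (fun s : ℝ => slicePairing g f (s • v)) (Set.Ioc 0 b) :=
    (LipschitzOnWith.of_dist_le_mul (K := C.toNNReal) fun s hs u hu => by
      rw [dist_eq_norm, dist_eq_norm]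
      exact (hlip u hu s hs).trans (by gcongr; exact Real.le_coe_toNNReal C)).uniformContinuousOn
  refine cauchy_map_iff_exists_tendsto.1 ?_
  have hc : Cauchy (𝓝[>] (0 : ℝ)) := cauchy_nhds.mono nhdsWithin_le_nhds
  refine hc.map_of_le huc ?_
  exact le_principal_iff.2 (Ioc_mem_nhdsGT hb)

lemma tendsto_sub_ray (hreg : HasSliceDeriv g U)
    (hseg : ∀ t ∈ Set.Icc (0 : ℝ) 1, ∀ s ∈ Set.Ioc 0 b, s • (v + t • w) ∈ U)
    (hb : 0 < b) (hP : SliceGrowth g v w b 0) (f : 𝓢(Fin d → ℝ, ℂ)) :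
    Tendsto (fun s : ℝ => slicePairing g f (s • (v + w)) - slicePairing g f (s • v))
      (𝓝[>] 0) (𝓝 0) := by
  obtain ⟨C, hC⟩ := hP (∂_{w} f)
  have hlim : Tendsto (fun s : ℝ => s * C) (𝓝[>] 0) (𝓝 0) := by
    simpa using ((continuous_id.mul continuous_const).tendsto (0 : ℝ)).mono_left
      (nhdsWithin_le_nhds (s := Set.Ioi 0)) (f := fun s : ℝ => s * C)
  refine squeeze_zero_norm' ?_ hlim
  filter_upwards [Ioc_mem_nhdsGT hb] with s hs
  have heq : ∀ t : ℝ, s • v + t • s • w = s • (v + t • w) := fun t => by module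
  have h := norm_image_sub_le_of_norm_deriv_le_segment_01'
    (f := fun t : ℝ => slicePairing g f (s • v + t • s • w)) (C := s * C)
    (fun t ht => (hreg.hasDerivAt f (s • v) (s • w) t
      (by rw [heq]; exact hseg t ht s hs)).hasDerivWithinAt)
    (fun t ht => by
      rw [slicePairing_lineDeriv_smul, heq, norm_mul, norm_neg, norm_I, one_mul, norm_mul,
        norm_real, Real.norm_of_nonneg hs.1.le]
      exact mul_le_mul_of_nonneg_left (by simpa using hC t ⟨ht.1, ht.2.le⟩ s hs) hs.1.le)
  simpa [heq] using h

end Segment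

section Cone

variable {V : Set (Fin d → ℝ)} {a : ℝ}

/-- The vectors of `V` of Euclidean norm less than `a`. -/
def truncatedCone (V : Set (Fin d → ℝ)) (a : ℝ) : Set (Fin d → ℝ) :=
  {y | y ∈ V ∧ Real.sqrt (∑ k, y k ^ 2) < a}

lemma isOpen_truncatedCone (hV : IsOpen V) : IsOpen (truncatedCone V a) :=
  hV.inter (isOpen_lt (f := fun y : Fin d → ℝ => Real.sqrt (∑ k, y k ^ 2)) (by fun_prop)
    continuous_const)

lemma sum_sq_pos {y : Fin d → ℝ} (hy : y ≠ 0) : 0 < ∑ k, y k ^ 2 := by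
  obtain ⟨k, hk⟩ := Function.ne_iff.1 hy
  exact Finset.sum_pos' (fun _ _ => sq_nonneg _) ⟨k, Finset.mem_univ k, by
    have : y k ≠ 0 := hk
    positivity⟩

lemma one_add_sum_sq_le (x : Fin d → ℝ) : 1 + ∑ k, x k ^ 2 ≤ (1 + d) * (1 + ‖x‖) ^ 2 := by
  have h : ∑ k, x k ^ 2 ≤ d * ‖x‖ ^ 2 := by
    refine (Finset.sum_le_card_nsmul Finset.univ _ (‖x‖ ^ 2) fun k _ => ?_).trans (by simp)
    rw [← sq_abs, ← Real.norm_eq_abs]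
    gcongr
    exact norm_le_pi_norm x k
  nlinarith [norm_nonneg x, mul_nonneg d.cast_nonneg (norm_nonneg x)]

lemma exists_segment_bounds (hV0 : (0 : Fin d → ℝ) ∉ V) {v w : Fin d → ℝ}
    (hv : ∀ t ∈ Set.Icc (0 : ℝ) 1, v + t • w ∈ V) :
    ∃ m > 0, ∃ R > 0, ∀ t ∈ Set.Icc (0 : ℝ) 1,
      m ≤ ∑ k, (v + t • w) k ^ 2 ∧ Real.sqrt (∑ k, (v + t • w) k ^ 2) < R := by
  have hc : Continuous fun t : ℝ => ∑ k, (v + t • w) k ^ 2 := by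
    simp only [Pi.add_apply, Pi.smul_apply]; fun_prop
  obtain ⟨t₀, ht₀, hmin⟩ := isCompact_Icc.exists_isMinOn (s := Set.Icc (0 : ℝ) 1)
    (by simp) hc.continuousOn
  obtain ⟨R, hR⟩ := isCompact_Icc.bddAbove_image (K := Set.Icc (0 : ℝ) 1)
    hc.sqrt.continuousOn
  have hR' : ∀ t ∈ Set.Icc (0 : ℝ) 1, Real.sqrt (∑ k, (v + t • w) k ^ 2) ≤ R := fun t ht =>
    hR ⟨t, ht, rfl⟩
  have hR0 : 0 ≤ R := (Real.sqrt_nonneg _).trans (hR' 0 (by simp))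
  exact ⟨_, sum_sq_pos fun h => hV0 (h ▸ hv t₀ ht₀), R + 1, by linarith,
    fun t ht => ⟨hmin ht, (hR' t ht).trans_lt (by linarith)⟩⟩

end Cone

end TubeBoundaryValue

/-- **Independence of the boundary value on the direction of approach within the cone.**
With `g` holomorphic on the tube `W = {x+iy : y ∈ V, ‖y‖ < a}` over an open convex cone
`V`, satisfying `|g(x+iy)| ≤ C (1+‖x‖²)^L ‖y‖^{-2K}`, for any `v₁, v₂ ∈ V` and any Schwartz
`f` the limits `lim_{ε→0+} ∫ g(x+iεvᵢ) f(x) dx` exist and coincide. -/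
theorem tube_domain_boundary_value_direction_independent
    (d : ℕ) (hd : 1 ≤ d)
    (V : Set (Fin d → ℝ))
    (hVopen : IsOpen V) (hVne : V.Nonempty) (hV0 : (0 : Fin d → ℝ) ∉ V)
    (hVcone : ∀ y ∈ V, ∀ y' ∈ V, ∀ l m : ℝ, 0 < l → 0 < m → l • y + m • y' ∈ V)
    (a : ℝ) (ha : 0 < a)
    (g : (Fin d → ℂ) → ℂ)
    (hg : DifferentiableOn ℂ g
      {z : Fin d → ℂ | (fun k => (z k).im) ∈ V ∧ Real.sqrt (∑ k, (z k).im ^ 2) < a})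
    (C : ℝ) (hC : 0 < C) (L K : ℕ)
    (hbound : ∀ z : Fin d → ℂ,
      (fun k => (z k).im) ∈ V → Real.sqrt (∑ k, (z k).im ^ 2) < a →
      ‖g z‖ ≤ C * (1 + ∑ k, (z k).re ^ 2) ^ L / (∑ k, (z k).im ^ 2) ^ K)
    (v₁ : Fin d → ℝ) (hv₁ : v₁ ∈ V) (v₂ : Fin d → ℝ) (hv₂ : v₂ ∈ V)
    (f : SchwartzMap (Fin d → ℝ) ℂ) :
    ∃ Lim : ℂ,
      Tendsto
        (fun ε : ℝ => ∫ x : Fin d → ℝ,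
          g (fun k => (x k : ℂ) + (ε * v₁ k : ℝ) * Complex.I) * f x)
        (nhdsWithin 0 (Set.Ioi 0)) (nhds Lim) ∧
      Tendsto
        (fun ε : ℝ => ∫ x : Fin d → ℝ,
          g (fun k => (x k : ℂ) + (ε * v₂ k : ℝ) * Complex.I) * f x)
        (nhdsWithin 0 (Set.Ioi 0)) (nhds Lim) := by
  have hU : IsOpen (truncatedCone V a) := isOpen_truncatedCone hVopen
  -- The growth bound in terms of `(1 + ‖x‖) ^ (2 * L)`.
  have hgrow : ∀ x, ∀ y ∈ truncatedCone V a,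
      ‖g (tubePoint x y)‖ ≤ C * (1 + d) ^ L / (∑ k, y k ^ 2) ^ K * (1 + ‖x‖) ^ (2 * L) := by
    intro x y hy
    have hre : ∀ k, (tubePoint x y k).re = x k := congrFun (re_tubePoint x y)
    have him : ∀ k, (tubePoint x y k).im = y k := congrFun (im_tubePoint x y)
    have h := hbound (tubePoint x y) (by simpa [im_tubePoint] using hy.1)
      (by simpa only [him] using hy.2)
    simp only [hre, him] at h
    rw [div_mul_eq_mul_div, mul_assoc C, pow_mul, ← mul_pow]
    refine h.trans ?_
    gcongr
    exact one_add_sum_sq_le x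
  have hloc : ∀ y ∈ truncatedCone V a, ∃ U ⊆ truncatedCone V a, IsOpen U ∧ y ∈ U ∧ ∃ M,
      ∀ x, ∀ y ∈ U, ‖g (tubePoint x y)‖ ≤ M * (1 + ‖x‖) ^ (2 * L) := by
    intro y hy
    have hpos : 0 < ∑ k, y k ^ 2 := sum_sq_pos fun h => hV0 (h ▸ hy.1)
    refine ⟨truncatedCone V a ∩ {u | (∑ k, y k ^ 2) / 2 < ∑ k, u k ^ 2}, Set.inter_subset_left,
      hU.inter (isOpen_lt continuous_const (by fun_prop)), ⟨hy, half_lt_self hpos⟩,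
      C * (1 + d) ^ L / ((∑ k, y k ^ 2) / 2) ^ K, fun x u hu => (hgrow x u hu.1).trans ?_⟩
    gcongr
    exact le_of_lt hu.2
  have hder : ∀ (f : 𝓢(Fin d → ℝ, ℂ)) (y w : Fin d → ℝ) (s : ℝ), y + s • w ∈ truncatedCone V a →
      HasDerivAt (fun s : ℝ => slicePairing g f (y + s • w))
        (-I * slicePairing g (∂_{w} f) (y + s • w)) s := by
    intro f y w s hy
    obtain ⟨U, hUsub, hUo, hyU, M, hM⟩ := hloc _ hy
    exact hasDerivAt_slicePairing hUo (hg.mono fun z hz => hUsub hz) hM f hyU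
  have hadd : ∀ (f h : 𝓢(Fin d → ℝ, ℂ)), ∀ y ∈ truncatedCone V a,
      slicePairing g (f + h) y = slicePairing g f y + slicePairing g h y := by
    intro f h y hy
    obtain ⟨U, hUsub, -, hyU, M, hM⟩ := hloc _ hy
    exact slicePairing_add (hg.mono fun z hz => hUsub hz) hM f h hyU
  have hreg : HasSliceDeriv g (truncatedCone V a) := ⟨hder, hadd⟩
  have hsegV : ∀ t ∈ Set.Icc (0 : ℝ) 1, v₁ + t • (v₂ - v₁) ∈ V := by
    rintro t ⟨h0, h1⟩
    rcases h0.eq_or_lt with rfl | h0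
    · simpa using hv₁
    rcases h1.eq_or_lt with rfl | h1
    · simpa using hv₂
    convert hVcone v₁ hv₁ v₂ hv₂ (1 - t) t (by linarith) h0 using 1
    module
  obtain ⟨m, hm, R, hR, hmR⟩ := exists_segment_bounds hV0 hsegV
  obtain ⟨b, hb, hb1, hbR⟩ : ∃ b : ℝ, 0 < b ∧ b ≤ 1 ∧ b * R ≤ a :=
    ⟨min 1 (a / R), by positivity, min_le_left _ _,
      (le_div_iff₀ hR).1 (min_le_right _ _)⟩
  have hsq : ∀ (s : ℝ) (y : Fin d → ℝ), ∑ k, (s • y) k ^ 2 = s ^ 2 * ∑ k, y k ^ 2 := fun s y => by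
    simp [mul_pow, Finset.mul_sum]
  have hseg : ∀ t ∈ Set.Icc (0 : ℝ) 1, ∀ s ∈ Set.Ioc 0 b,
      s • (v₁ + t • (v₂ - v₁)) ∈ truncatedCone V a := by
    intro t ht s hs
    refine ⟨?_, ?_⟩
    · convert hVcone _ (hsegV t ht) _ (hsegV t ht) (s / 2) (s / 2) (half_pos hs.1) (half_pos hs.1)
        using 1
      module
    · rw [hsq, Real.sqrt_mul (sq_nonneg s), Real.sqrt_sq hs.1.le]
      exact (mul_lt_mul' hs.2 (hmR t ht).2 (Real.sqrt_nonneg _) hb).trans_le hbR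
  have hgrowth : SliceGrowth g v₁ (v₂ - v₁) b ((2 * K : ℕ) + 1 / 2) := by
    intro f
    refine ⟨C * (1 + d) ^ L / m ^ K * ∫ x, (1 + ‖x‖) ^ (2 * L) * ‖f x‖, fun t ht s hs => ?_⟩
    refine (norm_slicePairing_le g (fun x => hgrow x _ (hseg t ht s hs)) f).trans ?_
    have hJ : 0 ≤ ∫ x, (1 + ‖x‖) ^ (2 * L) * ‖f x‖ := integral_nonneg fun x => by positivity
    have hs0 := hs.1
    have hpow : (s ^ (2 * K))⁻¹ ≤ s ^ (-(((2 * K : ℕ) : ℝ) + 1 / 2)) := by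
      rw [← Real.rpow_natCast, ← Real.rpow_neg hs.1.le]
      exact Real.rpow_le_rpow_of_exponent_ge hs.1 (hs.2.trans hb1) (by linarith)
    calc _ ≤ C * (1 + d) ^ L / (s ^ 2 * m) ^ K * ∫ x, (1 + ‖x‖) ^ (2 * L) * ‖f x‖ := by
          rw [hsq]
          gcongr
          exact (hmR t ht).1
      _ = C * (1 + d) ^ L / m ^ K * (∫ x, (1 + ‖x‖) ^ (2 * L) * ‖f x‖) * (s ^ (2 * K))⁻¹ := by
          rw [mul_pow, ← pow_mul]
          field_simp
      _ ≤ _ := by gcongr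
  have hbdd := SliceGrowth.zero hreg hseg hb hb1 (2 * K) hgrowth
  obtain ⟨l, hl⟩ := exists_tendsto_ray hreg hseg hb hbdd f
  refine ⟨l, hl, ?_⟩
  have h := (tendsto_sub_ray hreg hseg hb hbdd f).add hl
  simp only [sub_add_cancel, zero_add, add_sub_cancel] at h
  exact h
end
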